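/- For every Liouville number α there exists an area-preserving NICIS C∞ diffeomorphism of the closed annulus with rotation number α. Precisely: there exist a homeomorphism f of 𝔸 = (ℝ/ℤ)×[-1,1] preserving the product of Haar measure on ℝ/ℤ and Lebesgue measure on [-1,1], and a lift f̃ of f (a homeomorphism of ℝ×[-1,1] with f̃(x+1,y) = f̃(x,y)+(1,0) descending to f), such that: f̃ and f̃⁻¹ are C∞ maps of ℝ×[-1,1] ⊆ ℝ² (infinitely differentiable in the ContDiffOn sense); f admits no nonempty compact f-invariant subset contained in the interior (ℝ/ℤ)×(-1,1); and for every f-invariant Borel probability measure μ on 𝔸 one has ∫_𝔸 (p∘f̃ − p) dμ = α, where p : ℝ×[-1,1] → ℝ is the first-coordinate projection and p∘f̃ − p descends to a continuous function on 𝔸. -/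

import Mathlib

open MeasureTheory Set

attribute [local instance] MeasureTheory.Measure.Subtype.measureSpace

noncomputable section

/-- The closed annulus `𝔸 = (ℝ/ℤ) × [-1,1]`. -/
abbrev Annulus := AddCircle (1 : ℝ) × (Set.Icc (-1 : ℝ) 1)

/-- The universal cover `ℝ × [-1,1]` of the closed annulus. -/
abbrev AnnulusCover := ℝ × (Set.Icc (-1 : ℝ) 1)

/-- The covering projection `ℝ × [-1,1] → (ℝ/ℤ) × [-1,1]`. -/
def annulusProj (z : AnnulusCover) : Annulus := ((z.1 : AddCircle (1 : ℝ)), z.2)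

/-- The interior `(ℝ/ℤ) × (-1,1)` of the closed annulus. -/
def annulusInt : Set Annulus := {z | -1 < (z.2 : ℝ) ∧ (z.2 : ℝ) < 1}

/-- The upper boundary circle `(ℝ/ℤ) × {1}`. -/
def annulusBdryPlus : Set Annulus := {z | (z.2 : ℝ) = 1}

/-- `ft` is a lift of the homeomorphism `f` of the annulus: it commutes with the deck
transformation `(x,y) ↦ (x+1,y)` and descends to `f`. -/
def IsLift (f : Annulus ≃ₜ Annulus) (ft : AnnulusCover ≃ₜ AnnulusCover) : Prop :=
  (∀ z : AnnulusCover, ft (z.1 + 1, z.2) = ((ft z).1 + 1, (ft z).2)) ∧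
  (∀ z : AnnulusCover, f (annulusProj z) = annulusProj (ft z))

/-- `f` admits no nonempty compact invariant set contained in the interior of the annulus. -/
def NICIS (f : Annulus ≃ₜ Annulus) : Prop :=
  ¬ ∃ K : Set Annulus, K.Nonempty ∧ IsCompact K ∧ f '' K = K ∧ K ⊆ annulusInt

/-- A lifted area-preserving diffeomorphism of the annulus, extended by the identity to the plane:
it commutes with `(x, y) ↦ (x + 1, y)` and fixes every point outside `ℝ × (-1, 1)`. -/
structure IsAnnulusDiffeo (H : Equiv.Perm (ℝ × ℝ)) : Prop where
  contDiff : ContDiff ℝ (⊤ : ℕ∞) H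
  contDiff_symm : ContDiff ℝ (⊤ : ℕ∞) H.symm
  map_add_one : ∀ z, H (z + (1, 0)) = H z + (1, 0)
  map_eq_self : ∀ z : ℝ × ℝ, 1 ≤ |z.2| → H z = z
  measurePreserving : MeasurePreserving H volume volume

namespace IsAnnulusDiffeo

variable {G H : Equiv.Perm (ℝ × ℝ)}

theorem refl : IsAnnulusDiffeo (Equiv.refl _) :=
  ⟨contDiff_id, contDiff_id, fun _ => rfl, fun _ _ => rfl, MeasurePreserving.id _⟩

theorem symm (hH : IsAnnulusDiffeo H) : IsAnnulusDiffeo H.symm where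
  contDiff := hH.contDiff_symm
  contDiff_symm := hH.contDiff
  map_add_one z := by
    rw [Equiv.symm_apply_eq, hH.map_add_one, Equiv.apply_symm_apply]
  map_eq_self z hz := by
    rw [Equiv.symm_apply_eq, hH.map_eq_self z hz]
  measurePreserving := by
    let e : (ℝ × ℝ) ≃ᵐ (ℝ × ℝ) :=
      ⟨H, hH.contDiff.continuous.measurable, hH.contDiff_symm.continuous.measurable⟩
    exact MeasurePreserving.symm e hH.measurePreserving

theorem trans (hG : IsAnnulusDiffeo G) (hH : IsAnnulusDiffeo H) :
    IsAnnulusDiffeo (G.trans H) where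
  contDiff := hH.contDiff.comp hG.contDiff
  contDiff_symm := hG.contDiff_symm.comp hH.contDiff_symm
  map_add_one z := by simp [hG.map_add_one, hH.map_add_one]
  map_eq_self z hz := by simp [hG.map_eq_self z hz, hH.map_eq_self z hz]
  measurePreserving := hH.measurePreserving.comp hG.measurePreserving

theorem pow (hH : IsAnnulusDiffeo H) (n : ℕ) : IsAnnulusDiffeo (H ^ n) := by
  induction n with
  | zero => exact refl
  | succ n ih => rw [pow_succ]; exact hH.trans ih

end IsAnnulusDiffeo

theorem exists_norm_le_of_periodic {F : Type*} [NormedAddCommGroup F] {f : ℝ × ℝ → F}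
    (hf : Continuous f) (hper : ∀ z, f (z + (1, 0)) = f z)
    (hzero : ∀ z : ℝ × ℝ, 1 < |z.2| → f z = 0) : ∃ C, ∀ z, ‖f z‖ ≤ C := by
  have hK : IsCompact (Icc (0 : ℝ) 1 ×ˢ Icc (-1 : ℝ) 1) := isCompact_Icc.prod isCompact_Icc
  obtain ⟨C, hC⟩ := hK.exists_bound_of_continuousOn hf.continuousOn
  refine ⟨C, fun z => ?_⟩
  by_cases hz : 1 < |z.2|
  · rw [hzero z hz, norm_zero]
    exact (norm_nonneg _).trans (hC (0, 0) (by simp))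
  · have hp : Function.Periodic (fun x => f (x, z.2)) 1 := fun x => by
      simpa using hper (x, z.2)
    obtain ⟨x, hx, hxz⟩ := hp.exists_mem_Ico₀ one_pos z.1
    have : f z = f (x, z.2) := hxz
    rw [this]
    exact hC _ ⟨⟨hx.1, hx.2.le⟩, abs_le.1 (not_lt.1 hz)⟩

/-- All derivatives of a smooth function on the plane which descends to the annulus and vanishes
outside of it are bounded. -/
theorem exists_norm_iteratedFDeriv_le_of_periodic {F : Type*} [NormedAddCommGroup F]
    [NormedSpace ℝ F] {f : ℝ × ℝ → F} (hf : ContDiff ℝ (⊤ : ℕ∞) f)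
    (hper : ∀ z, f (z + (1, 0)) = f z) (hzero : ∀ z : ℝ × ℝ, 1 < |z.2| → f z = 0) (i : ℕ) :
    ∃ C, ∀ z, ‖iteratedFDeriv ℝ i f z‖ ≤ C := by
  refine exists_norm_le_of_periodic (hf.continuous_iteratedFDeriv (by exact_mod_cast le_top))
    (fun z => ?_) (fun z hz => ?_)
  · rw [← iteratedFDeriv_comp_add_right]
    simp only [hper]
  · have hev : f =ᶠ[nhds z] fun _ => 0 := by
      have ho : IsOpen {w : ℝ × ℝ | 1 < |w.2|} :=
        isOpen_lt continuous_const (by fun_prop)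
      filter_upwards [ho.mem_nhds hz] with w hw using hzero w hw
    rw [(hev.iteratedFDeriv ℝ i).eq_of_nhds]
    simp

theorem norm_iteratedFDeriv_clm_le {E F : Type*} [NormedAddCommGroup E] [NormedSpace ℝ E]
    [NormedAddCommGroup F] [NormedSpace ℝ F] (L : E →L[ℝ] F) {i : ℕ} (hi : 1 ≤ i) (z : E) :
    ‖iteratedFDeriv ℝ i L z‖ ≤ ‖L‖ := by
  obtain ⟨i, rfl⟩ := Nat.exists_eq_add_of_le' hi
  rw [← norm_iteratedFDeriv_fderiv]
  have : fderiv ℝ L = fun _ => L := by ext1 w; exact L.fderiv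
  rw [this]
  cases i with
  | zero => simp
  | succ i => rw [iteratedFDeriv_succ_const]; simp

theorem iteratedFDeriv_sub_const {E F : Type*} [NormedAddCommGroup E] [NormedSpace ℝ E]
    [NormedAddCommGroup F] [NormedSpace ℝ F] (u : E → F) (c : F) {i : ℕ} (hi : 1 ≤ i)
    (hu : ContDiff ℝ (⊤ : ℕ∞) u) (x : E) :
    iteratedFDeriv ℝ i (fun w => u w - c) x = iteratedFDeriv ℝ i u x := by
  obtain ⟨i, rfl⟩ := Nat.exists_eq_add_of_le' hi
  have : (fun w => u w - c) = u + fun _ => -c := by ext1 w; simp [sub_eq_add_neg]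
  rw [this, iteratedFDeriv_add_apply
    ((hu.of_le (by exact_mod_cast le_top)).contDiffAt) contDiffAt_const, iteratedFDeriv_succ_const]
  simp

theorem IsAnnulusDiffeo.exists_norm_iteratedFDeriv_le {H : Equiv.Perm (ℝ × ℝ)}
    (hH : IsAnnulusDiffeo H) (i : ℕ) :
    ∃ C, 1 ≤ i → ∀ z, ‖iteratedFDeriv ℝ i H z‖ ≤ C := by
  have hP : ContDiff ℝ (⊤ : ℕ∞) (fun z => H z - z) := hH.contDiff.sub contDiff_id
  obtain ⟨C, hC⟩ := exists_norm_iteratedFDeriv_le_of_periodic hP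
    (fun z => by rw [hH.map_add_one]; abel)
    (fun z hz => by rw [hH.map_eq_self z hz.le, sub_self]) i
  refine ⟨C + ‖ContinuousLinearMap.id ℝ (ℝ × ℝ)‖, fun hi z => ?_⟩
  have hsum : (H : ℝ × ℝ → ℝ × ℝ) = (fun z => H z - z) + ⇑(ContinuousLinearMap.id ℝ (ℝ × ℝ)) := by
    ext1 z; simp
  rw [hsum, iteratedFDeriv_add_apply]
  · exact (norm_add_le _ _).trans (add_le_add (hC z) (norm_iteratedFDeriv_clm_le _ hi z))
  · exact (hP.of_le (by exact_mod_cast le_top)).contDiffAt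
  · exact (ContinuousLinearMap.contDiff _).contDiffAt

theorem IsAnnulusDiffeo.exists_norm_sub_le {H : Equiv.Perm (ℝ × ℝ)}
    (hH : IsAnnulusDiffeo H) : ∃ C, ∀ z, ‖H z - z‖ ≤ C :=
  exists_norm_le_of_periodic (hH.contDiff.continuous.sub continuous_id)
    (fun z => by rw [hH.map_add_one]; abel)
    (fun z hz => by rw [hH.map_eq_self z hz.le, sub_self])

/-- A family of smooth maps whose derivatives of each positive order are bounded by a polynomial
in the parameter. -/
structure IsPolyBdd {E F : Type*} [NormedAddCommGroup E] [NormedSpace ℝ E]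
    [NormedAddCommGroup F] [NormedSpace ℝ F] (A : ℕ → E → F) : Prop where
  contDiff : ∀ q, ContDiff ℝ (⊤ : ℕ∞) (A q)
  bound : ∀ i, ∃ (C : ℝ) (k : ℕ), 1 ≤ i → ∀ q, 1 ≤ q → ∀ z,
    ‖iteratedFDeriv ℝ i (A q) z‖ ≤ C * (q : ℝ) ^ k

namespace IsPolyBdd

variable {E F G : Type*} [NormedAddCommGroup E] [NormedSpace ℝ E]
  [NormedAddCommGroup F] [NormedSpace ℝ F] [NormedAddCommGroup G] [NormedSpace ℝ G]

theorem exists_uniform {A : ℕ → E → F} (hA : IsPolyBdd A) (N : ℕ) :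
    ∃ (C : ℝ) (k : ℕ), 1 ≤ C ∧ ∀ q, 1 ≤ q → ∀ i, 1 ≤ i → i ≤ N → ∀ z,
      ‖iteratedFDeriv ℝ i (A q) z‖ ≤ C * (q : ℝ) ^ k := by
  induction N with
  | zero => exact ⟨1, 0, le_rfl, fun q _ i h1 h2 => by omega⟩
  | succ N ih =>
    obtain ⟨C, k, hC1, hC⟩ := ih
    obtain ⟨C', k', hC'⟩ := hA.bound (N + 1)
    refine ⟨max C C', max k k', le_max_of_le_left hC1, fun q hq i h1 h2 z => ?_⟩
    have hq' : (1 : ℝ) ≤ q := by exact_mod_cast hq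
    have hmax : 0 ≤ max C C' := zero_le_one.trans (le_max_of_le_left hC1)
    rcases Nat.le_succ_iff.1 h2 with h | rfl
    · refine (hC q hq i h1 h z).trans ?_
      gcongr
      · exact le_max_left _ _
      · exact le_max_left _ _
    · refine (hC' h1 q hq z).trans ?_
      gcongr
      · exact le_max_right _ _
      · exact le_max_right _ _

theorem comp {B : ℕ → F → G} {A : ℕ → E → F} (hB : IsPolyBdd B) (hA : IsPolyBdd A) :
    IsPolyBdd (fun q => B q ∘ A q) where
  contDiff q := (hB.contDiff q).comp (hA.contDiff q)
  bound i := by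
    obtain ⟨C, k, hC1, hC⟩ := hB.exists_uniform i
    obtain ⟨D, l, hD1, hD⟩ := hA.exists_uniform i
    refine ⟨i.factorial * C * D ^ i, k + l * i, fun hi q hq z => ?_⟩
    have hq' : (1 : ℝ) ≤ q := by exact_mod_cast hq
    -- the composition estimate also wants a bound on the outer map itself: subtract a constant
    let b : F → G := fun w => B q w - B q (A q z)
    have hb : ContDiff ℝ (⊤ : ℕ∞) b := (hB.contDiff q).sub contDiff_const
    have hbA : (fun w => (B q ∘ A q) w - B q (A q z)) = b ∘ A q := rfl
    rw [← iteratedFDeriv_sub_const (B q ∘ A q) (B q (A q z)) hi ((hB.contDiff q).comp (hA.contDiff q)), hbA]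
    have key := norm_iteratedFDeriv_comp_le (n := i) (C := C * (q : ℝ) ^ k)
      (D := D * (q : ℝ) ^ l) hb (hA.contDiff q) (by exact_mod_cast le_top) z
      (fun j hj => ?_) (fun j h1 h2 => ?_)
    · refine key.trans (le_of_eq ?_)
      rw [mul_pow, ← pow_mul, pow_add]
      ring
    · rcases Nat.eq_zero_or_pos j with rfl | hj0
      · simp only [norm_iteratedFDeriv_zero, b, sub_self, norm_zero]
        positivity
      · rw [iteratedFDeriv_sub_const (B q) _ hj0 (hB.contDiff q)]
        exact hC q hq j hj0 hj _
    · refine (hD q hq j h1 h2 z).trans (le_self_pow₀ ?_ (by omega))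
      exact one_le_mul_of_one_le_of_one_le hD1 (one_le_pow₀ hq')

theorem clm {L : ℕ → E →L[ℝ] F} {C : ℝ} {k : ℕ}
    (hL : ∀ q, 1 ≤ q → ‖L q‖ ≤ C * (q : ℝ) ^ k) : IsPolyBdd (fun q => ⇑(L q)) where
  contDiff q := (L q).contDiff
  bound _ := ⟨C, k, fun hi q hq z => (norm_iteratedFDeriv_clm_le _ hi z).trans (hL q hq)⟩

/-- Conjugates of nearby translations are close in every `C^N` norm, with polynomial control. -/
theorem exists_norm_iteratedFDeriv_translate_sub_le {A : ℕ → F → G} {B : ℕ → E → F}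
    (hA : IsPolyBdd A) (hB : IsPolyBdd B) (N : ℕ) :
    ∃ (C : ℝ) (k : ℕ), 0 ≤ C ∧ ∀ q, 1 ≤ q → ∀ a b : F, ∀ i, i ≤ N → ∀ z,
      ‖iteratedFDeriv ℝ i (fun w => A q (B q w + a) - A q (B q w + b)) z‖ ≤
        C * (q : ℝ) ^ k * ‖a - b‖ := by
  obtain ⟨C, k, hC1, hC⟩ := hA.exists_uniform (N + 1)
  obtain ⟨D, l, hD1, hD⟩ := hB.exists_uniform N
  refine ⟨N.factorial * C * D ^ N, k + l * N, by positivity, fun q hq a b i hi z => ?_⟩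
  have hq' : (1 : ℝ) ≤ q := by exact_mod_cast hq
  have hDq : 1 ≤ D * (q : ℝ) ^ l := one_le_mul_of_one_le_of_one_le hD1 (one_le_pow₀ hq')
  have hAs := hA.contDiff q
  have hAt : ∀ c : F, ContDiff ℝ (⊤ : ℕ∞) fun w => A q (w + c) := fun c =>
    hAs.comp (contDiff_id.add contDiff_const)
  let u : F → G := fun w => A q (w + a) - A q (w + b)
  have hu : ContDiff ℝ (⊤ : ℕ∞) u := (hAt a).sub (hAt b)
  have hbound : ∀ j ≤ N, ∀ w, ‖iteratedFDeriv ℝ j u w‖ ≤ C * (q : ℝ) ^ k * ‖a - b‖ := by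
    intro j hj w
    have hsub : u = (fun w => A q (w + a)) - fun w => A q (w + b) := rfl
    rw [hsub, iteratedFDeriv_sub_apply
      (((hAt a).of_le (by exact_mod_cast le_top)).contDiffAt)
      (((hAt b).of_le (by exact_mod_cast le_top)).contDiffAt),
      iteratedFDeriv_comp_add_right, iteratedFDeriv_comp_add_right]
    have hmv := Convex.norm_image_sub_le_of_norm_fderiv_le (𝕜 := ℝ)
      (f := iteratedFDeriv ℝ j (A q)) (s := univ) (x := w + b) (y := w + a)
      (C := C * (q : ℝ) ^ k)
      (fun x _ => (hAs.differentiable_iteratedFDeriv (by exact_mod_cast WithTop.coe_lt_top _)) x)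
      (fun x _ => ?_) convex_univ (mem_univ _) (mem_univ _)
    · simpa using hmv
    · rw [norm_fderiv_iteratedFDeriv]
      exact hC q hq (j + 1) (by omega) (by omega) x
  have hcomp : (fun w => A q (B q w + a) - A q (B q w + b)) = u ∘ B q := rfl
  rw [hcomp]
  have key := norm_iteratedFDeriv_comp_le (n := i) (C := C * (q : ℝ) ^ k * ‖a - b‖)
    (D := D * (q : ℝ) ^ l) hu (hB.contDiff q) (by exact_mod_cast le_top) z
    (fun j hj => hbound j (hj.trans hi) _)
    (fun j h1 h2 => (hD q hq j h1 (h2.trans hi) z).trans (le_self_pow₀ hDq (by omega)))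
  refine key.trans ?_
  calc (i.factorial : ℝ) * (C * (q : ℝ) ^ k * ‖a - b‖) * (D * (q : ℝ) ^ l) ^ i
      ≤ N.factorial * (C * (q : ℝ) ^ k * ‖a - b‖) * (D * (q : ℝ) ^ l) ^ N := by
        gcongr
    _ = _ := by rw [mul_pow, ← pow_mul, pow_add]; ring

end IsPolyBdd

theorem IsAnnulusDiffeo.isPolyBdd {H : Equiv.Perm (ℝ × ℝ)} (hH : IsAnnulusDiffeo H) :
    IsPolyBdd (fun _ : ℕ => ⇑H) where
  contDiff _ := hH.contDiff
  bound i := by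
    obtain ⟨C, hC⟩ := hH.exists_norm_iteratedFDeriv_le i
    exact ⟨C, 0, fun hi q _ z => by simpa using hC hi z⟩

/-- A sufficiently small smooth Lipschitz perturbation of the identity is a diffeomorphism. -/
theorem exists_homeomorph_add_of_lipschitzWith {E : Type*} [NormedAddCommGroup E]
    [NormedSpace ℝ E] [CompleteSpace E] [Nontrivial E] {P : E → E}
    (hP : ContDiff ℝ (⊤ : ℕ∞) P) (hL : LipschitzWith (1 / 2) P) :
    ∃ e : E ≃ₜ E, (∀ z, e z = z + P z) ∧ ContDiff ℝ (⊤ : ℕ∞) e.symm := by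
  have happ : ApproximatesLinearOn (fun z => z + P z)
      ((ContinuousLinearEquiv.refl ℝ E : E ≃L[ℝ] E) : E →L[ℝ] E) univ (1 / 2) := by
    intro x _ y _
    have := hL.dist_le_mul x y
    rw [dist_eq_norm, dist_eq_norm] at this
    have hxy : x + P x - (y + P y) - (x - y) = P x - P y := by abel
    change ‖x + P x - (y + P y) - (x - y)‖ ≤ _
    rwa [hxy]
  have hc : (1 / 2 : NNReal) <
      ‖((ContinuousLinearEquiv.refl ℝ E : E ≃L[ℝ] E).symm : E →L[ℝ] E)‖₊⁻¹ := by
    have : ‖((ContinuousLinearEquiv.refl ℝ E : E ≃L[ℝ] E).symm : E →L[ℝ] E)‖₊ = 1 :=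
      NNReal.eq ContinuousLinearMap.norm_id
    rw [this, inv_one]
    exact NNReal.half_lt_self one_ne_zero
  let e := happ.toHomeomorph _ (Or.inr hc)
  have he : ∀ z, e z = z + P z := fun z => rfl
  have hsmall : ∀ a, ‖-(fderiv ℝ P a)‖ < 1 := fun a => by
    rw [norm_neg]
    refine (norm_fderiv_le_of_lipschitz ℝ hL).trans_lt ?_
    norm_num
  refine ⟨e, he, e.contDiff_symm (f₀' := fun a =>
    ContinuousLinearEquiv.unitsEquiv ℝ E (Units.oneSub _ (hsmall a))) (fun a => ?_) ?_⟩
  · have hd : HasFDerivAt (fun z => z + P z) (ContinuousLinearMap.id ℝ E + fderiv ℝ P a) a :=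
      (hasFDerivAt_id a).add (hP.differentiable (by simp) a).hasFDerivAt
    have hunit : ((ContinuousLinearEquiv.unitsEquiv ℝ E (Units.oneSub _ (hsmall a)) : E ≃L[ℝ] E) :
        E →L[ℝ] E) = ContinuousLinearMap.id ℝ E + fderiv ℝ P a := by
      ext x
      change ((1 : E →L[ℝ] E) - -(fderiv ℝ P a)) x = _
      simp
    rw [hunit]
    exact hd
  · exact contDiff_id.add hP

theorem ContinuousLinearMap.det_real_prod (L : ℝ × ℝ →L[ℝ] ℝ × ℝ) :
    L.det = (L (1, 0)).1 * (L (0, 1)).2 - (L (0, 1)).1 * (L (1, 0)).2 := by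
  rw [ContinuousLinearMap.det, ← LinearMap.det_toMatrix (Module.Basis.finTwoProd ℝ),
    Matrix.det_fin_two]
  simp [LinearMap.toMatrix_apply]

/-- Two bijections of the plane with the same Jacobian differ by an area-preserving map. -/
theorem measurePreserving_symm_trans_of_det_eq {e₁ e₂ : (ℝ × ℝ) ≃ₜ (ℝ × ℝ)}
    {e₁' e₂' : ℝ × ℝ → ℝ × ℝ →L[ℝ] ℝ × ℝ} (h₁ : ∀ z, HasFDerivAt e₁ (e₁' z) z)
    (h₂ : ∀ z, HasFDerivAt e₂ (e₂' z) z) (hdet : ∀ z, (e₁' z).det = (e₂' z).det) :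
    MeasurePreserving (e₁.symm.trans e₂) volume volume := by
  have m₁ := map_withDensity_abs_det_fderiv_eq_addHaar (volume : Measure (ℝ × ℝ))
    MeasurableSet.univ.nullMeasurableSet (fun z _ => (h₁ z).hasFDerivWithinAt) e₁.injective.injOn
  have m₂ := map_withDensity_abs_det_fderiv_eq_addHaar (volume : Measure (ℝ × ℝ))
    MeasurableSet.univ.nullMeasurableSet (fun z _ => (h₂ z).hasFDerivWithinAt) e₂.injective.injOn
  simp only [Measure.restrict_univ, image_univ, e₁.surjective.range_eq,
    e₂.surjective.range_eq] at m₁ m₂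
  simp only [hdet] at m₁
  refine ⟨(e₁.symm.trans e₂).continuous.measurable, ?_⟩
  have hcomp : ⇑(e₁.symm.trans e₂) = e₂ ∘ e₁.symm := rfl
  rw [hcomp]
  nth_rewrite 1 [← m₁]
  rw [Measure.map_map (e₂.continuous.comp e₁.symm.continuous).measurable e₁.continuous.measurable]
  have : (e₂ ∘ e₁.symm) ∘ e₁ = e₂ := by ext1 z; simp
  rw [this, m₂]

/-- The flat bump function `exp (-1 / (1 - y ^ 2))` on `(-1, 1)`, extended by zero. -/
def flatBump (y : ℝ) : ℝ := expNegInvGlue (1 - y ^ 2)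

theorem contDiff_flatBump : ContDiff ℝ (⊤ : ℕ∞) flatBump :=
  expNegInvGlue.contDiff.comp (contDiff_const.sub (contDiff_id.pow 2))

theorem flatBump_nonneg (y : ℝ) : 0 ≤ flatBump y := expNegInvGlue.nonneg _

theorem flatBump_eq_zero {y : ℝ} (hy : 1 ≤ |y|) : flatBump y = 0 :=
  expNegInvGlue.zero_of_nonpos (by nlinarith [sq_abs y])

theorem flatBump_pos {y : ℝ} (hy : |y| < 1) : 0 < flatBump y :=
  expNegInvGlue.pos_of_pos (by nlinarith [sq_abs y, abs_nonneg y])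

theorem flatBump_neg (y : ℝ) : flatBump (-y) = flatBump y := by simp [flatBump]

theorem deriv_flatBump_eq_zero {y : ℝ} (hy : 1 ≤ |y|) : deriv flatBump y = 0 := by
  refine IsLocalMin.deriv_eq_zero (Filter.Eventually.of_forall fun x => ?_)
  rw [flatBump_eq_zero hy]
  exact flatBump_nonneg x

theorem contDiff_deriv_flatBump : ContDiff ℝ (⊤ : ℕ∞) (deriv flatBump) :=
  ContDiff.deriv' (n := (⊤ : ℕ∞)) contDiff_flatBump

theorem exists_smul_lipschitzWith {P : ℝ × ℝ → ℝ × ℝ} (hP : ContDiff ℝ (⊤ : ℕ∞) P)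
    (hper : ∀ z, P (z + (1, 0)) = P z) (hzero : ∀ z : ℝ × ℝ, 1 ≤ |z.2| → P z = 0) :
    ∃ δ : ℝ, 0 < δ ∧ ∀ c, 0 ≤ c → c ≤ δ → LipschitzWith (1 / 2) (fun z => c • P z) := by
  obtain ⟨M, hM⟩ := exists_norm_iteratedFDeriv_le_of_periodic hP hper
    (fun z hz => hzero z hz.le) 1
  simp only [norm_iteratedFDeriv_one] at hM
  have hM0 : 0 ≤ M := (norm_nonneg _).trans (hM 0)
  refine ⟨1 / (2 * (M + 1)), by positivity, fun c hc0 hc => ?_⟩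
  have hd : Differentiable ℝ P := hP.differentiable (by simp)
  refine lipschitzWith_of_nnnorm_fderiv_le (𝕜 := ℝ) (hd.const_smul c) fun z => ?_
  rw [← NNReal.coe_le_coe, coe_nnnorm]
  have : (fun z => c • P z) = c • P := rfl
  rw [this, fderiv_const_smul (hd z), norm_smul, Real.norm_of_nonneg hc0]
  calc c * ‖fderiv ℝ P z‖ ≤ 1 / (2 * (M + 1)) * (M + 1) := by
        gcongr
        exact (hM z).trans (by linarith)
    _ = ((1 / 2 : NNReal) : ℝ) := by push_cast; field_simp

/-- The horizontal displacement of the generating function `flatBump y * sin (2πx)`. -/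
def pushX (z : ℝ × ℝ) : ℝ × ℝ := (deriv flatBump z.2 * Real.sin (2 * Real.pi * z.1), 0)

/-- The vertical displacement of the generating function `flatBump y * sin (2πx)`. -/
def pushY (z : ℝ × ℝ) : ℝ × ℝ :=
  (0, flatBump z.2 * (2 * Real.pi * Real.cos (2 * Real.pi * z.1)))

theorem contDiff_pushX : ContDiff ℝ (⊤ : ℕ∞) pushX :=
  ((contDiff_deriv_flatBump.comp contDiff_snd).mul
    (Real.contDiff_sin.comp (contDiff_const.mul contDiff_fst))).prodMk contDiff_const

theorem contDiff_pushY : ContDiff ℝ (⊤ : ℕ∞) pushY :=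
  contDiff_const.prodMk ((contDiff_flatBump.comp contDiff_snd).mul
    (contDiff_const.mul (Real.contDiff_cos.comp (contDiff_const.mul contDiff_fst))))

theorem pushX_periodic (z : ℝ × ℝ) : pushX (z + (1, 0)) = pushX z := by simp [pushX, mul_add]

theorem pushY_periodic (z : ℝ × ℝ) : pushY (z + (1, 0)) = pushY z := by simp [pushY, mul_add]

theorem pushX_eq_zero {z : ℝ × ℝ} (hz : 1 ≤ |z.2|) : pushX z = 0 := by
  simp [pushX, deriv_flatBump_eq_zero hz]

theorem pushY_eq_zero {z : ℝ × ℝ} (hz : 1 ≤ |z.2|) : pushY z = 0 := by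
  simp [pushY, flatBump_eq_zero hz]

theorem det_id_add_smul_fderiv_pushX (c : ℝ) (z : ℝ × ℝ) :
    (ContinuousLinearMap.id ℝ (ℝ × ℝ) + c • fderiv ℝ pushX z).det =
      1 + c * (deriv flatBump z.2 * (2 * Real.pi * Real.cos (2 * Real.pi * z.1))) := by
  have h₁ : HasFDerivAt (fun z : ℝ × ℝ => 2 * Real.pi * z.1)
      ((2 * Real.pi) • ContinuousLinearMap.fst ℝ ℝ ℝ) z := hasFDerivAt_fst.const_mul (2 * Real.pi)
  have h₂ : HasFDerivAt (fun z : ℝ × ℝ => deriv flatBump z.2)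
      (deriv (deriv flatBump) z.2 • ContinuousLinearMap.snd ℝ ℝ ℝ) z :=
    (contDiff_deriv_flatBump.differentiable (by simp) z.2).hasDerivAt.comp_hasFDerivAt z
      hasFDerivAt_snd
  have h₃ : HasFDerivAt pushX _ z := (h₂.mul h₁.sin).prodMk (hasFDerivAt_const (0 : ℝ) z)
  rw [ContinuousLinearMap.det_real_prod, h₃.fderiv]
  simp [-mul_eq_mul_left_iff, -add_right_inj]
  ring

theorem det_id_add_smul_fderiv_pushY (c : ℝ) (z : ℝ × ℝ) :
    (ContinuousLinearMap.id ℝ (ℝ × ℝ) + c • fderiv ℝ pushY z).det =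
      1 + c * (deriv flatBump z.2 * (2 * Real.pi * Real.cos (2 * Real.pi * z.1))) := by
  have h₁ : HasFDerivAt (fun z : ℝ × ℝ => 2 * Real.pi * z.1)
      ((2 * Real.pi) • ContinuousLinearMap.fst ℝ ℝ ℝ) z := hasFDerivAt_fst.const_mul (2 * Real.pi)
  have h₂ : HasFDerivAt (fun z : ℝ × ℝ => flatBump z.2)
      (deriv flatBump z.2 • ContinuousLinearMap.snd ℝ ℝ ℝ) z :=
    (contDiff_flatBump.differentiable (by simp) z.2).hasDerivAt.comp_hasFDerivAt z
      hasFDerivAt_snd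
  have h₃ : HasFDerivAt pushY _ z :=
    (hasFDerivAt_const (0 : ℝ) z).prodMk (h₂.mul (h₁.cos.const_mul (2 * Real.pi)))
  rw [ContinuousLinearMap.det_real_prod, h₃.fderiv]
  simp [-mul_eq_mul_left_iff, -add_right_inj]
  ring

/-- An area-preserving diffeomorphism, defined by a generating function, which pushes the segment
`{0} × (-1, 1)` upwards and the segment `{1/2} × (-1, 1)` downwards. -/
theorem exists_isAnnulusDiffeo_push :
    ∃ (g : Equiv.Perm (ℝ × ℝ)) (c : ℝ), IsAnnulusDiffeo g ∧ 0 < c ∧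
      (∀ y, g (0, y) = (0, y + c * flatBump y)) ∧
      (∀ y, g (1 / 2, y) = (1 / 2, y - c * flatBump y)) ∧
      Monotone fun y => y + c * flatBump y := by
  obtain ⟨δ₁, hδ₁, hP1⟩ := exists_smul_lipschitzWith contDiff_pushX pushX_periodic (fun _ => pushX_eq_zero)
  obtain ⟨δ₂, hδ₂, hQ1⟩ := exists_smul_lipschitzWith contDiff_pushY pushY_periodic (fun _ => pushY_eq_zero)
  obtain ⟨c, hc0, hc1, hc2⟩ : ∃ c, 0 < c ∧ c ≤ δ₁ ∧ c ≤ δ₂ :=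
    ⟨min δ₁ δ₂, lt_min hδ₁ hδ₂, min_le_left _ _, min_le_right _ _⟩
  have hQlip := hQ1 c hc0.le hc2
  have hX : ContDiff ℝ (⊤ : ℕ∞) fun z => c • pushX z := contDiff_pushX.const_smul c
  have hY : ContDiff ℝ (⊤ : ℕ∞) fun z => c • pushY z := contDiff_pushY.const_smul c
  obtain ⟨U, hU, hUs⟩ := exists_homeomorph_add_of_lipschitzWith hX (hP1 c hc0.le hc1)
  obtain ⟨V, hV, hVs⟩ := exists_homeomorph_add_of_lipschitzWith hY hQlip
  have hUdiff : ContDiff ℝ (⊤ : ℕ∞) U := by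
    rw [show ⇑U = fun z => z + c • pushX z from funext hU]
    exact contDiff_id.add hX
  have hVdiff : ContDiff ℝ (⊤ : ℕ∞) V := by
    rw [show ⇑V = fun z => z + c • pushY z from funext hV]
    exact contDiff_id.add hY
  have hUd : ∀ z, HasFDerivAt U (ContinuousLinearMap.id ℝ (ℝ × ℝ) + c • fderiv ℝ pushX z) z := by
    intro z
    rw [show ⇑U = fun z => z + c • pushX z from funext hU]
    exact (hasFDerivAt_id z).add ((contDiff_pushX.differentiable (by simp) z).hasFDerivAt.const_smul c)
  have hVd : ∀ z, HasFDerivAt V (ContinuousLinearMap.id ℝ (ℝ × ℝ) + c • fderiv ℝ pushY z) z := by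
    intro z
    rw [show ⇑V = fun z => z + c • pushY z from funext hV]
    exact (hasFDerivAt_id z).add ((contDiff_pushY.differentiable (by simp) z).hasFDerivAt.const_smul c)
  refine ⟨(U.symm.trans V).toEquiv, c * (2 * Real.pi),
    ⟨hVdiff.comp hUs, hUdiff.comp hVs, fun z => ?_, fun z hz => ?_, ?_⟩, by positivity,
    fun y => ?_, fun y => ?_, fun y y' hy => ?_⟩
  · have hUper : U.symm (z + (1, 0)) = U.symm z + (1, 0) := by
      rw [Homeomorph.symm_apply_eq, hU, pushX_periodic, add_right_comm, ← hU, Homeomorph.apply_symm_apply]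
    change V (U.symm (z + (1, 0))) = V (U.symm z) + (1, 0)
    rw [hUper, hV, pushY_periodic, add_right_comm, ← hV]
  · have hUz : U.symm z = z := by
      rw [Homeomorph.symm_apply_eq, hU, pushX_eq_zero hz, smul_zero, add_zero]
    change V (U.symm z) = z
    rw [hUz, hV, pushY_eq_zero hz, smul_zero, add_zero]
  · refine measurePreserving_symm_trans_of_det_eq hUd hVd fun z => ?_
    rw [det_id_add_smul_fderiv_pushX, det_id_add_smul_fderiv_pushY]
  · have hUz : U.symm (0, y) = (0, y) := by
      rw [Homeomorph.symm_apply_eq, hU]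
      simp [pushX]
    change V (U.symm (0, y)) = _
    rw [hUz, hV]
    simp [pushY]
    ring
  · have hpi : 2 * Real.pi * (1 / 2) = Real.pi := by ring
    have hUz : U.symm (1 / 2, y) = (1 / 2, y) := by
      rw [Homeomorph.symm_apply_eq, hU]
      simp only [pushX, hpi, Real.sin_pi]
      simp
    change V (U.symm (1 / 2, y)) = _
    rw [hUz, hV]
    simp only [pushY, hpi, Real.cos_pi]
    ext
    · simp
    · simp
      ring
  · have hl := hQlip.dist_le_mul (0, y) (0, y')
    rw [Prod.dist_eq, Prod.dist_eq] at hl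
    simp only [dist_self, Real.dist_eq, pushY, Prod.smul_mk, smul_eq_mul, mul_zero,
      Real.cos_zero, mul_one, abs_nonneg, max_eq_right, NNReal.coe_div, NNReal.coe_one,
      NNReal.coe_ofNat] at hl
    rw [abs_of_nonpos (sub_nonpos.2 hy)] at hl
    have := (abs_le.1 hl).2
    dsimp only
    nlinarith

theorem map_add_int_of_map_add_one {F : ℝ × ℝ → ℝ × ℝ} (hF : ∀ z, F (z + (1, 0)) = F z + (1, 0))
    (n : ℤ) (z : ℝ × ℝ) : F (z + ((n : ℝ), 0)) = F z + ((n : ℝ), 0) := by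
  induction n using Int.induction_on with
  | zero =>
    have h0 : (((0 : ℤ) : ℝ), (0 : ℝ)) = 0 := by simp
    rw [h0, add_zero, add_zero]
  | succ i ih =>
    have hi : (((i + 1 : ℤ) : ℝ), (0 : ℝ)) = (((i : ℤ) : ℝ), 0) + (1, 0) := by simp
    rw [hi, ← add_assoc, hF, ih, add_assoc]
  | pred i ih =>
    have hi : (((-i : ℤ) : ℝ), (0 : ℝ)) = (((-i - 1 : ℤ) : ℝ), 0) + (1, 0) := by simp
    rw [hi, ← add_assoc, hF, ← add_assoc] at ih
    exact add_right_cancel ih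

/-- The linear map `(x, y) ↦ (r * x, y)`. -/
def stretch (r : ℝ) : ℝ × ℝ →L[ℝ] ℝ × ℝ :=
  (r • ContinuousLinearMap.fst ℝ ℝ ℝ).prod (ContinuousLinearMap.snd ℝ ℝ ℝ)

@[simp]
theorem stretch_apply (r : ℝ) (z : ℝ × ℝ) : stretch r z = (r * z.1, z.2) := by simp [stretch]

theorem norm_stretch_le {r C : ℝ} (hr : |r| ≤ C) (hC : 1 ≤ C) : ‖stretch r‖ ≤ C := by
  refine ContinuousLinearMap.opNorm_le_bound _ (zero_le_one.trans hC) fun z => ?_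
  rw [stretch_apply, Prod.norm_def, Prod.norm_def]
  refine max_le ?_ ?_
  · rw [norm_mul]
    exact mul_le_mul hr (le_max_left _ _) (norm_nonneg _) (zero_le_one.trans hC)
  · exact (le_max_right _ _).trans (le_mul_of_one_le_left (le_max_of_le_left (norm_nonneg _)) hC)

/-- The lift of a map of the annulus to its `q`-fold cover, rescaled to an annulus. -/
def coverLift (q : ℕ) (hq : q ≠ 0) (g : Equiv.Perm (ℝ × ℝ)) : Equiv.Perm (ℝ × ℝ) where
  toFun z := stretch (1 / q) (g (stretch q z))
  invFun z := stretch (1 / q) (g.symm (stretch q z))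
  left_inv z := by
    have hq' : (q : ℝ) ≠ 0 := by exact_mod_cast hq
    simp [hq']
  right_inv z := by
    have hq' : (q : ℝ) ≠ 0 := by exact_mod_cast hq
    simp [hq']

theorem coverLift_apply (q : ℕ) (hq : q ≠ 0) (g : Equiv.Perm (ℝ × ℝ)) (z : ℝ × ℝ) :
    coverLift q hq g z = stretch (1 / q) (g (stretch q z)) := rfl

theorem IsAnnulusDiffeo.coverLift_map_add {g : Equiv.Perm (ℝ × ℝ)} (hg : IsAnnulusDiffeo g)
    {q : ℕ} (hq : q ≠ 0) (p : ℤ) (z : ℝ × ℝ) :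
    coverLift q hq g (z + ((p : ℝ) / q, 0)) = coverLift q hq g z + ((p : ℝ) / q, 0) := by
  have hq' : (q : ℝ) ≠ 0 := by exact_mod_cast hq
  have h₁ : stretch q (z + ((p : ℝ) / q, 0)) = stretch q z + ((p : ℝ), 0) := by
    rw [map_add]
    congr 1
    simp [mul_div_cancel₀ _ hq']
  rw [coverLift_apply, coverLift_apply, h₁, map_add_int_of_map_add_one hg.map_add_one, map_add]
  congr 1
  simp
  ring

theorem IsAnnulusDiffeo.isAnnulusDiffeo_coverLift {g : Equiv.Perm (ℝ × ℝ)} (hg : IsAnnulusDiffeo g)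
    {q : ℕ} (hq : q ≠ 0) : IsAnnulusDiffeo (coverLift q hq g) := by
  have hq' : (q : ℝ) ≠ 0 := by exact_mod_cast hq
  refine ⟨(stretch _).contDiff.comp (hg.contDiff.comp (stretch _).contDiff),
    (stretch _).contDiff.comp (hg.contDiff_symm.comp (stretch _).contDiff), fun z => ?_,
    fun z hz => ?_, ?_⟩
  · have := hg.coverLift_map_add hq q z
    simpa [hq'] using this
  · rw [coverLift_apply, hg.map_eq_self _ (by simpa using hz)]
    simp [hq']
  · have hdet : (stretch (q : ℝ)).det ≠ 0 := by
      rw [ContinuousLinearMap.det_real_prod]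
      simpa using hq
    have hmap := Measure.map_linearMap_addHaar_eq_smul_addHaar (volume : Measure (ℝ × ℝ))
      (f := (stretch (q : ℝ)).toLinearMap) hdet
    set c := ENNReal.ofReal |(LinearMap.det (stretch (q : ℝ)).toLinearMap)⁻¹|
    have hm : ∀ r, Measurable (stretch r) := fun r => (stretch r).continuous.measurable
    have hgm : Measurable g := hg.contDiff.continuous.measurable
    have hinv : stretch (1 / (q : ℝ)) ∘ stretch (q : ℝ) = id := by
      ext1 z
      simp [hq']
    refine ⟨(hm _).comp (hgm.comp (hm _)), ?_⟩
    change Measure.map (stretch (1 / (q : ℝ)) ∘ g ∘ stretch (q : ℝ)) volume = volume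
    rw [← Measure.map_map (hm _) (hgm.comp (hm _)), ← Measure.map_map hgm (hm _)]
    have hmap' : Measure.map (stretch (q : ℝ)) volume = c • (volume : Measure (ℝ × ℝ)) := hmap
    rw [hmap', Measure.map_smul, hg.measurePreserving.map_eq, ← hmap', Measure.map_map (hm _) (hm _),
      hinv, Measure.map_id]

theorem exists_lt_iterate_add_flatBump {c : ℝ} (hc : 0 < c) {ε : ℝ} (hε : 0 < ε) :
    ∃ n : ℕ, 1 - ε < (fun y => y + c * flatBump y)^[n] 0 := by
  set φ : ℝ → ℝ := fun y => y + c * flatBump y with hφ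
  by_contra! hcon
  have hle : ∀ y, y ≤ φ y := fun y => le_add_of_nonneg_right
    (mul_nonneg hc.le (flatBump_nonneg y))
  have hseq : Monotone fun n : ℕ => φ^[n] 0 := monotone_nat_of_le_succ fun n => by
    rw [Function.iterate_succ_apply']
    exact hle _
  have hlim := tendsto_atTop_ciSup hseq ⟨1 - ε, by rintro _ ⟨n, rfl⟩; exact hcon n⟩
  set y := ⨆ n : ℕ, φ^[n] 0
  have hcont : Continuous φ := continuous_id.add
    (continuous_const.mul contDiff_flatBump.continuous)
  have hfix : φ y = y := isFixedPt_of_tendsto_iterate hlim hcont.continuousAt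
  have hy1 : y ≤ 1 - ε := le_of_tendsto' hlim hcon
  have hy0 : 0 ≤ y := ge_of_tendsto' hlim fun n => hseq (Nat.zero_le n)
  have hpos : 0 < c * flatBump y := mul_pos hc
    (flatBump_pos (by rw [abs_of_nonneg hy0]; linarith))
  have : y + c * flatBump y = y := hfix
  linarith

/-- There is an area-preserving diffeomorphism for which the image of every horizontal circle
comes close to the boundary. -/
theorem exists_isAnnulusDiffeo_near_boundary {ε : ℝ} (hε : 0 < ε) :
    ∃ g : Equiv.Perm (ℝ × ℝ), IsAnnulusDiffeo g ∧
      ∀ y ∈ Icc (-1 : ℝ) 1, ∃ x, 1 - ε < |(g (x, y)).2| := by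
  obtain ⟨g, c, hg, hc, hup, hdown, hmono⟩ := exists_isAnnulusDiffeo_push
  obtain ⟨n, hn⟩ := exists_lt_iterate_add_flatBump hc hε
  set φ : ℝ → ℝ := fun y => y + c * flatBump y with hφ
  have hup' : ∀ (n : ℕ) y, (g ^ n) (0, y) = (0, φ^[n] y) := by
    intro n
    induction n with
    | zero => intro y; rfl
    | succ n ih =>
      intro y
      rw [pow_succ, Equiv.Perm.mul_apply, hup, ih, Function.iterate_succ_apply]
  have hdown' : ∀ (n : ℕ) y, (g ^ n) (1 / 2, y) = (1 / 2, -φ^[n] (-y)) := by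
    intro n
    induction n with
    | zero => intro y; simp
    | succ n ih =>
      intro y
      have : -(y - c * flatBump y) = φ (-y) := by simp only [hφ, flatBump_neg]; ring
      rw [pow_succ, Equiv.Perm.mul_apply, hdown, ih, Function.iterate_succ_apply, this]
  refine ⟨g ^ n, hg.pow n, fun y _ => ?_⟩
  rcases le_total 0 y with h | h
  · refine ⟨0, ?_⟩
    rw [hup']
    exact (hn.trans_le (hmono.iterate n h)).trans_le (le_abs_self _)
  · refine ⟨1 / 2, ?_⟩
    rw [hdown', abs_neg]
    exact (hn.trans_le (hmono.iterate n (neg_nonneg.2 h))).trans_le (le_abs_self _)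

theorem IsAnnulusDiffeo.abs_snd_le_one {H : Equiv.Perm (ℝ × ℝ)} (hH : IsAnnulusDiffeo H)
    {z : ℝ × ℝ} (hz : |z.2| ≤ 1) : |(H z).2| ≤ 1 := by
  by_contra! hcon
  have h : H z = z := H.injective (hH.map_eq_self (H z) hcon.le)
  rw [h] at hcon
  exact absurd hz (not_le.2 hcon)

theorem IsAnnulusDiffeo.exists_lipschitzWith {H : Equiv.Perm (ℝ × ℝ)} (hH : IsAnnulusDiffeo H) :
    ∃ C, LipschitzWith C H := by
  obtain ⟨C, hC⟩ := hH.exists_norm_iteratedFDeriv_le 1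
  refine ⟨C.toNNReal, lipschitzWith_of_nnnorm_fderiv_le (𝕜 := ℝ)
    (hH.contDiff.differentiable (by simp)) fun z => ?_⟩
  rw [← NNReal.coe_le_coe, coe_nnnorm]
  have h := hC le_rfl z
  rw [norm_iteratedFDeriv_one] at h
  exact h.trans (Real.le_coe_toNNReal C)

theorem IsAnnulusDiffeo.exists_near_boundary {H : Equiv.Perm (ℝ × ℝ)} (hH : IsAnnulusDiffeo H)
    {ε : ℝ} (hε : 0 < ε) :
    ∃ δ > 0, ∀ z : ℝ × ℝ, |z.2| ≤ 1 → 1 - δ < |z.2| → 1 - ε < |(H z).2| := by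
  obtain ⟨C, hC⟩ := hH.exists_lipschitzWith
  refine ⟨ε / (C + 1), by positivity, fun z hz1 hz2 => ?_⟩
  obtain ⟨s, hs1, hs⟩ : ∃ s : ℝ, |s| = 1 ∧ |z.2 - s| = 1 - |z.2| := by
    rcases le_total 0 z.2 with h | h
    · refine ⟨1, by simp, ?_⟩
      rw [abs_of_nonneg h] at hz1 ⊢
      rw [abs_of_nonpos (by linarith)]
      ring
    · refine ⟨-1, by simp, ?_⟩
      rw [abs_of_nonpos h] at hz1 ⊢
      rw [abs_of_nonneg (by linarith)]
      ring
  have hd := hC.dist_le_mul z (z.1, s)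
  rw [hH.map_eq_self (z.1, s) hs1.ge] at hd
  have h₁ : |(H z).2 - s| ≤ dist (H z) (z.1, s) := by
    rw [Prod.dist_eq, ← Real.dist_eq]
    exact le_max_right _ _
  have h₂ : dist z (z.1, s) = 1 - |z.2| := by
    rw [Prod.dist_eq, dist_self, Real.dist_eq, hs]
    exact max_eq_right (by linarith)
  rw [h₂] at hd
  have h₃ : |s| - |(H z).2| ≤ |(H z).2 - s| := by
    rw [abs_sub_comm]
    exact abs_sub_abs_le_abs_sub _ _
  have h₄ : (C : ℝ) * (1 - |z.2|) ≤ (C + 1) * (1 - |z.2|) := by nlinarith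
  have h₅ : ((C : ℝ) + 1) * (1 - |z.2|) < ε := by
    rw [mul_comm, ← lt_div_iff₀ (by positivity)]
    linarith
  linarith

/-- The conjugate by `H` of the translation `(x, y) ↦ (x + t, y)`. -/
def conjTranslation (H : Equiv.Perm (ℝ × ℝ)) (t : ℝ) : Equiv.Perm (ℝ × ℝ) :=
  H.symm.trans ((Equiv.addRight (t, 0)).trans H)

theorem conjTranslation_apply (H : Equiv.Perm (ℝ × ℝ)) (t : ℝ) (z : ℝ × ℝ) :
    conjTranslation H t z = H (H.symm z + (t, 0)) := rfl

theorem IsAnnulusDiffeo.contDiff_conjTranslation {H : Equiv.Perm (ℝ × ℝ)}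
    (hH : IsAnnulusDiffeo H) (t : ℝ) : ContDiff ℝ (⊤ : ℕ∞) (conjTranslation H t) :=
  hH.contDiff.comp (hH.contDiff_symm.add contDiff_const)

/-- One step of the approximation by conjugation scheme: for a Liouville number `α`, the
diffeomorphism `H` can be modified so that the images of horizontal circles come close to the
boundary while the conjugates of the rotations by `±α` hardly change. -/
theorem IsAnnulusDiffeo.exists_approx {α : ℝ} (hα : Liouville α) {H : Equiv.Perm (ℝ × ℝ)}
    (hH : IsAnnulusDiffeo H) {ε : ℝ} (hε : 0 < ε) (N : ℕ) :
    ∃ H' : Equiv.Perm (ℝ × ℝ), IsAnnulusDiffeo H' ∧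
      (∀ t, t = α ∨ t = -α → ∀ i ≤ N, ∀ z, ‖iteratedFDeriv ℝ i
        (fun w => conjTranslation H' t w - conjTranslation H t w) z‖ ≤ ε) ∧
      (∀ K, (∀ z, |(H z).1 - z.1| ≤ K) → ∀ z, |(H' z).1 - z.1| ≤ K + ε) ∧
      ∀ y ∈ Icc (-1 : ℝ) 1, ∃ x, 1 - ε < |(H' (x, y)).2| := by
  obtain ⟨δ, hδ, hδH⟩ := hH.exists_near_boundary hε
  obtain ⟨g, hg, hgy⟩ := exists_isAnnulusDiffeo_near_boundary hδ
  have hSq : IsPolyBdd fun q : ℕ => ⇑(stretch (q : ℝ)) :=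
    IsPolyBdd.clm (C := 1) (k := 1) fun q hq => by
      have hq' : (1 : ℝ) ≤ q := by exact_mod_cast hq
      exact norm_stretch_le (by simp) (by simpa using hq')
  have hSi : IsPolyBdd fun q : ℕ => ⇑(stretch (1 / (q : ℝ))) :=
    IsPolyBdd.clm (C := 1) (k := 0) fun q hq => by
      have hq' : (1 : ℝ) ≤ q := by exact_mod_cast hq
      refine norm_stretch_le ?_ (by simp)
      rw [abs_of_nonneg (by positivity), pow_zero, mul_one]
      exact div_le_one_of_le₀ hq' (by positivity)
  obtain ⟨C, k, hC0, hC⟩ :=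
    (hH.isPolyBdd.comp (hSi.comp (hg.isPolyBdd.comp hSq))).exists_norm_iteratedFDeriv_translate_sub_le
      (hSi.comp (hg.symm.isPolyBdd.comp (hSq.comp hH.symm.isPolyBdd))) N
  obtain ⟨D, l, hD0, hD⟩ :=
    hH.isPolyBdd.exists_norm_iteratedFDeriv_translate_sub_le hH.symm.isPolyBdd N
  obtain ⟨M, hM⟩ := hg.exists_norm_sub_le
  have hM0 : 0 ≤ M := (norm_nonneg _).trans (hM 0)
  obtain ⟨q, ⟨p, -, hpq⟩, hq⟩ := ((hα.frequently_exists_num (k + l + 1)).and_eventually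
    (Filter.eventually_ge_atTop (⌈(C + D + M) / ε⌉₊ + 1))).exists
  have hq1 : 1 ≤ q := by omega
  have hq0 : q ≠ 0 := by omega
  have hq1' : (1 : ℝ) ≤ q := by exact_mod_cast hq1
  have hqpos : (0 : ℝ) < q := by linarith
  have hqε : (C + D + M) / q ≤ ε := by
    rw [div_le_iff₀ hqpos, mul_comm, ← div_le_iff₀ hε]
    refine (Nat.le_ceil _).trans ?_
    exact_mod_cast (Nat.le_succ _).trans hq
  have hh := hg.isAnnulusDiffeo_coverLift hq0
  set h := coverLift q hq0 g
  refine ⟨h.trans H, hh.trans hH, ?_, fun K hK z => ?_, fun y hy => ?_⟩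
  · have key : ∀ (t : ℝ) (r : ℤ), |t - r / q| < 1 / (q : ℝ) ^ (k + l + 1) → ∀ i ≤ N, ∀ z,
        ‖iteratedFDeriv ℝ i
          (fun w => conjTranslation (h.trans H) t w - conjTranslation H t w) z‖ ≤ ε := by
      intro t r htr i hi z
      have hcomm : ∀ w, conjTranslation (h.trans H) (r / q) w = conjTranslation H (r / q) w := by
        intro w
        rw [conjTranslation_apply, conjTranslation_apply, Equiv.trans_apply,
          Equiv.symm_trans_apply, hg.coverLift_map_add hq0, Equiv.apply_symm_apply]
      let u : ℝ × ℝ → ℝ × ℝ := fun w =>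
        conjTranslation (h.trans H) t w - conjTranslation (h.trans H) (r / q) w
      let v : ℝ × ℝ → ℝ × ℝ := fun w => conjTranslation H t w - conjTranslation H (r / q) w
      have hu : ContDiff ℝ (⊤ : ℕ∞) u :=
        ((hh.trans hH).contDiff_conjTranslation _).sub ((hh.trans hH).contDiff_conjTranslation _)
      have hv : ContDiff ℝ (⊤ : ℕ∞) v :=
        (hH.contDiff_conjTranslation _).sub (hH.contDiff_conjTranslation _)
      have huv : (fun w => conjTranslation (h.trans H) t w - conjTranslation H t w) = u - v := by
        ext1 w
        simp only [u, v, Pi.sub_apply, hcomm]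
        abel
      have hnorm : ‖((t, 0) : ℝ × ℝ) - ((r : ℝ) / q, 0)‖ = |t - r / q| := by
        simp [Prod.norm_def]
      have hbu := hC q hq1 (t, 0) ((r : ℝ) / q, 0) i hi z
      have hbv := hD q hq1 (t, 0) ((r : ℝ) / q, 0) i hi z
      rw [hnorm] at hbu hbv
      have hpow : ∀ (B : ℝ) (m : ℕ), 0 ≤ B → m ≤ k + l →
          B * (q : ℝ) ^ m * |t - r / q| ≤ B / q := by
        intro B m hB hm
        calc B * (q : ℝ) ^ m * |t - r / q|
            ≤ B * (q : ℝ) ^ (k + l) * (1 / (q : ℝ) ^ (k + l + 1)) := by gcongr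
          _ = B / q := by rw [pow_succ]; field_simp
      rw [huv, iteratedFDeriv_sub_apply ((hu.of_le (by exact_mod_cast le_top)).contDiffAt)
        ((hv.of_le (by exact_mod_cast le_top)).contDiffAt)]
      calc _ ≤ ‖iteratedFDeriv ℝ i u z‖ + ‖iteratedFDeriv ℝ i v z‖ := norm_sub_le _ _
        _ ≤ C / q + D / q := add_le_add (hbu.trans (hpow C k hC0 (by omega)))
            (hbv.trans (hpow D l hD0 (by omega)))
        _ ≤ (C + D + M) / q := by
            rw [← add_div]
            exact div_le_div_of_nonneg_right (by linarith) hqpos.le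
        _ ≤ ε := hqε
    rintro t (rfl | rfl)
    · exact key t p hpq
    · refine key (-α) (-p) ?_
      rw [← abs_neg]
      convert hpq using 2
      push_cast
      ring
  · have h₁ : |(h z).1 - z.1| ≤ ε := by
      have h₂ : (h z).1 - z.1 = ((g (stretch q z)).1 - (stretch q z).1) / q := by
        simp only [h, coverLift_apply, stretch_apply]
        field_simp
      rw [h₂, abs_div, Nat.abs_cast]
      refine le_trans ?_ hqε
      gcongr
      have h₃ := (norm_fst_le _).trans (hM (stretch q z))
      rw [Prod.fst_sub, Real.norm_eq_abs] at h₃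
      linarith
    have h₄ := hK (h z)
    rw [Equiv.trans_apply]
    calc |(H (h z)).1 - z.1| = |((H (h z)).1 - (h z).1) + ((h z).1 - z.1)| := by ring_nf
      _ ≤ K + ε := (abs_add_le _ _).trans (add_le_add h₄ h₁)
  · obtain ⟨x, hx⟩ := hgy y hy
    have hy' : |y| ≤ 1 := abs_le.2 hy
    have hhx : (h (x / q, y)).2 = (g (x, y)).2 := by
      simp only [h, coverLift_apply, stretch_apply]
      rw [mul_div_cancel₀ _ hqpos.ne']
    refine ⟨x / q, ?_⟩
    rw [Equiv.trans_apply]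
    refine hδH _ ?_ ?_
    · rw [hhx]; exact hg.abs_snd_le_one hy'
    · rw [hhx]; exact hx

theorem Irrational.exists_add_nat_mul_mem {α : ℝ} (hα : Irrational α) {U : Set ℝ} (hU : IsOpen U)
    (hne : U.Nonempty) (hper : ∀ x ∈ U, ∀ n : ℤ, x + n ∈ U) (x : ℝ) :
    ∃ m : ℕ, x + m * α ∈ U := by
  have hdense : DenseRange fun m : ℕ => m • (α : AddCircle (1 : ℝ)) :=
    denseRange_zsmul_iff_nsmul.1 (AddCircle.denseRange_zsmul_coe_iff.2 (by simpa using hα))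
  have hV : IsOpen (((↑) : ℝ → AddCircle (1 : ℝ)) '' ((x + ·) ⁻¹' U)) :=
    QuotientAddGroup.isOpenMap_coe _ (hU.preimage (continuous_const_add x))
  obtain ⟨u, hu⟩ := hne
  obtain ⟨m, v, hv, hmv⟩ := hdense.exists_mem_open hV
    ⟨_, u - x, show x + (u - x) ∈ U by simpa using hu, rfl⟩
  have h0 : ((m • α - v : ℝ) : AddCircle (1 : ℝ)) = 0 := by
    rw [AddCircle.coe_sub, AddCircle.coe_nsmul, hmv, sub_self]
  obtain ⟨n, hn⟩ := (AddCircle.coe_eq_zero_iff 1).1 h0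
  refine ⟨m, ?_⟩
  convert hper _ hv n using 1
  simp only [zsmul_eq_mul, mul_one, nsmul_eq_mul] at hn
  rw [hn]
  ring

theorem conjTranslation_iterate (H : Equiv.Perm (ℝ × ℝ)) (t : ℝ) (m : ℕ) (z : ℝ × ℝ) :
    (conjTranslation H t)^[m] z = H (H.symm z + (m * t, 0)) := by
  induction m with
  | zero =>
    have h0 : (((0 : ℕ) : ℝ) * t, (0 : ℝ)) = 0 := by simp
    rw [h0]
    simp
  | succ m ih =>
    rw [Function.iterate_succ_apply', ih, conjTranslation_apply, Equiv.symm_apply_apply, add_assoc]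
    congr 2
    simp
    ring

theorem IsAnnulusDiffeo.exists_iterate_near_boundary {H : Equiv.Perm (ℝ × ℝ)}
    (hH : IsAnnulusDiffeo H) {α ε : ℝ} (hα : Irrational α)
    (h : ∀ y ∈ Icc (-1 : ℝ) 1, ∃ x, 1 - ε < |(H (x, y)).2|) {z : ℝ × ℝ} (hz : |z.2| ≤ 1) :
    ∃ m : ℕ, 1 - ε < |((conjTranslation H α)^[m] z).2| := by
  set w := H.symm z with hw
  obtain ⟨m, hm⟩ := hα.exists_add_nat_mul_mem
    (U := {x | 1 - ε < |(H (x, w.2)).2|})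
    (isOpen_lt continuous_const (continuous_snd.comp (hH.contDiff.continuous.comp
      (Continuous.prodMk_left w.2))).abs)
    (h w.2 (abs_le.1 (hH.symm.abs_snd_le_one hz)))
    (fun x hx n => by
      have := map_add_int_of_map_add_one hH.map_add_one n (x, w.2)
      simp only [Prod.mk_add_mk, add_zero] at this
      simpa [this] using hx) w.1
  refine ⟨m, ?_⟩
  rw [conjTranslation_iterate, ← hw]
  have h₁ : w + (m * α, 0) = (w.1 + m * α, w.2) := by ext <;> simp
  rw [h₁]
  exact hm

theorem exists_forall_iterate_mem {X : Type*} [MetricSpace X] {F : X → X}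
    (hF : Continuous F) (m : ℕ) (z : X) {O : Set X} (hO : O ∈ nhds (F^[m] z)) :
    ∃ η > 0, ∃ W ∈ nhds z, ∀ G : X → X, (∀ w, dist (G w) (F w) ≤ η) → ∀ w ∈ W, G^[m] w ∈ O := by
  induction m generalizing z with
  | zero => exact ⟨1, one_pos, O, hO, fun G _ w hw => hw⟩
  | succ m ih =>
    rw [Function.iterate_succ_apply] at hO
    obtain ⟨η, hη, W, hW, h⟩ := ih (F z) hO
    obtain ⟨r, hr, hrW⟩ := Metric.mem_nhds_iff.1 hW
    refine ⟨min η (r / 2), by positivity, F ⁻¹' Metric.ball (F z) (r / 2),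
      hF.continuousAt.preimage_mem_nhds (Metric.ball_mem_nhds _ (by positivity)),
      fun G hG w hw => ?_⟩
    rw [Function.iterate_succ_apply]
    refine h G (fun w => (hG w).trans (min_le_left _ _)) _ (hrW ?_)
    have h₁ := (hG w).trans (min_le_right _ _)
    have h₂ : dist (F w) (F z) < r / 2 := hw
    rw [Metric.mem_ball]
    linarith [dist_triangle (G w) (F w) (F z)]

theorem IsCompact.exists_forall_exists_iterate_mem {X : Type*} [MetricSpace X] {F : X → X}
    (hF : Continuous F) {S O : Set X} (hS : IsCompact S) (hO : IsOpen O)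
    (h : ∀ z ∈ S, ∃ m : ℕ, F^[m] z ∈ O) :
    ∃ η > 0, ∀ G : X → X, (∀ w, dist (G w) (F w) ≤ η) → ∀ w ∈ S, ∃ m : ℕ, G^[m] w ∈ O := by
  refine hS.induction_on (p := fun S => ∃ η > 0, ∀ G : X → X, (∀ w, dist (G w) (F w) ≤ η) →
    ∀ w ∈ S, ∃ m : ℕ, G^[m] w ∈ O) ⟨1, one_pos, by simp⟩ ?_ ?_ ?_
  · rintro s t hst ⟨η, hη, ht⟩
    exact ⟨η, hη, fun G hG w hw => ht G hG w (hst hw)⟩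
  · rintro s t ⟨η, hη, hs⟩ ⟨θ, hθ, ht⟩
    refine ⟨min η θ, lt_min hη hθ, fun G hG w hw => hw.elim ?_ ?_⟩
    · exact hs G (fun w => (hG w).trans (min_le_left _ _)) w
    · exact ht G (fun w => (hG w).trans (min_le_right _ _)) w
  · intro z hz
    obtain ⟨m, hm⟩ := h z hz
    obtain ⟨η, hη, W, hW, hG⟩ := exists_forall_iterate_mem hF m z (hO.mem_nhds hm)
    exact ⟨W, mem_nhdsWithin_of_mem_nhds hW, η, hη, fun G h w hw => ⟨m, hG G h w hw⟩⟩

/-- Every point of the fundamental domain of the annulus has an iterate under `F` that is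
`ε`-close to the boundary. -/
def ReachesBoundary (F : ℝ × ℝ → ℝ × ℝ) (ε : ℝ) : Prop :=
  ∀ z ∈ Icc (0 : ℝ) 1 ×ˢ Icc (-1 : ℝ) 1, ∃ m : ℕ, 1 - ε < |(F^[m] z).2|

theorem IsAnnulusDiffeo.exists_approx_reachesBoundary {α : ℝ} (hα : Liouville α)
    {H : Equiv.Perm (ℝ × ℝ)} (hH : IsAnnulusDiffeo H) {ε : ℝ} (hε : 0 < ε) (N : ℕ) :
    ∃ H' : Equiv.Perm (ℝ × ℝ), ∃ η : ℝ, IsAnnulusDiffeo H' ∧ 0 < η ∧ η ≤ ε / 2 ∧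
      (∀ t, t = α ∨ t = -α → ∀ i ≤ N, ∀ z, ‖iteratedFDeriv ℝ i
        (fun w => conjTranslation H' t w - conjTranslation H t w) z‖ ≤ ε) ∧
      (∀ K, (∀ z, |(H z).1 - z.1| ≤ K) → ∀ z, |(H' z).1 - z.1| ≤ K + ε) ∧
      ∀ F : ℝ × ℝ → ℝ × ℝ, (∀ z, ‖F z - conjTranslation H' α z‖ ≤ 2 * η) →
        ReachesBoundary F ε := by
  obtain ⟨H', hH', h₁, h₂, h₃⟩ := hH.exists_approx hα hε N
  obtain ⟨η, hη, h⟩ := (isCompact_Icc.prod isCompact_Icc :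
      IsCompact (Icc (0 : ℝ) 1 ×ˢ Icc (-1 : ℝ) 1)).exists_forall_exists_iterate_mem
    (hH'.contDiff_conjTranslation α).continuous
    (O := {z | 1 - ε < |z.2|}) (isOpen_lt continuous_const continuous_snd.abs)
    fun z hz => hH'.exists_iterate_near_boundary hα.irrational h₃ (abs_le.2 hz.2)
  refine ⟨H', min (η / 2) (ε / 2), hH', by positivity, min_le_right _ _, h₁, h₂,
    fun F hF => h F fun w => ?_⟩
  rw [dist_eq_norm]
  linarith [hF w, min_le_left (η / 2) (ε / 2)]

/-- The sequence of conjugating diffeomorphisms of the approximation by conjugation scheme. -/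
theorem exists_approx_seq {α : ℝ} (hα : Liouville α) :
    ∃ (H : ℕ → Equiv.Perm (ℝ × ℝ)) (e : ℕ → ℝ), (∀ n, IsAnnulusDiffeo (H n)) ∧ (∀ n, 0 < e n) ∧
      (∀ n, e (n + 1) ≤ e n / 2) ∧
      (∀ t, t = α ∨ t = -α → ∀ n, ∀ i ≤ n, ∀ z, ‖iteratedFDeriv ℝ i
        (fun w => conjTranslation (H (n + 1)) t w - conjTranslation (H n) t w) z‖ ≤ e n) ∧
      (∃ K, ∀ n z, |(H n z).1 - z.1| ≤ K) ∧
      ∀ n, ∀ F : ℝ × ℝ → ℝ × ℝ, (∀ z, ‖F z - conjTranslation (H (n + 1)) α z‖ ≤ 2 * e (n + 1)) →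
        ReachesBoundary F (e n) := by
  choose! H' η h₁ h₂ h₃ h₄ h₅ h₆ using fun (H : Equiv.Perm (ℝ × ℝ)) (hH : IsAnnulusDiffeo H)
    (ε : ℝ) (hε : 0 < ε) (N : ℕ) => hH.exists_approx_reachesBoundary hα hε N
  let s : ℕ → Equiv.Perm (ℝ × ℝ) × ℝ := fun n => n.rec (Equiv.refl _, 1)
    fun n p => (H' p.1 p.2 n, η p.1 p.2 n)
  have hs : ∀ n, IsAnnulusDiffeo (s n).1 ∧ 0 < (s n).2 := by
    intro n
    induction n with
    | zero => exact ⟨IsAnnulusDiffeo.refl, one_pos⟩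
    | succ n ih => exact ⟨h₁ _ ih.1 _ ih.2 n, h₂ _ ih.1 _ ih.2 n⟩
  have he : ∀ n, (s (n + 1)).2 ≤ (s n).2 / 2 := fun n => h₃ _ (hs n).1 _ (hs n).2 n
  refine ⟨fun n => (s n).1, fun n => (s n).2, fun n => (hs n).1, fun n => (hs n).2, he,
    fun t ht n => h₄ _ (hs n).1 _ (hs n).2 n t ht, ⟨2, fun n => ?_⟩,
    fun n => h₆ _ (hs n).1 _ (hs n).2 n⟩
  have hK : ∀ z, |((s n).1 z).1 - z.1| ≤ 2 - 2 * (s n).2 := by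
    induction n with
    | zero => intro z; simp [s]
    | succ n ih =>
      intro z
      refine (h₅ _ (hs n).1 _ (hs n).2 n _ ih z).trans ?_
      linarith [he n]
  exact fun z => (hK z).trans (by linarith [(hs n).2])

theorem le_mul_half_pow {e : ℕ → ℝ} (he : ∀ n, e (n + 1) ≤ e n / 2) (n i : ℕ) :
    e (n + i) ≤ e n * (1 / 2) ^ i := by
  induction i with
  | zero => simp
  | succ i ih =>
    refine (he (n + i)).trans ?_
    rw [pow_succ]
    linarith

theorem exists_contDiff_of_norm_iteratedFDeriv_sub_le {E : Type*} [NormedAddCommGroup E]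
    [NormedSpace ℝ E] [CompleteSpace E] {F : ℕ → E → E} {e : ℕ → ℝ}
    (hF : ∀ n, ContDiff ℝ (⊤ : ℕ∞) (F n)) (hpos : ∀ n, 0 < e n) (he : ∀ n, e (n + 1) ≤ e n / 2)
    (h : ∀ n, ∀ i ≤ n, ∀ z, ‖iteratedFDeriv ℝ i (fun w => F (n + 1) w - F n w) z‖ ≤ e n) :
    ∃ G : E → E, ContDiff ℝ (⊤ : ℕ∞) G ∧ ∀ n z, ‖G z - F n z‖ ≤ 2 * e n := by
  have hsum : ∀ n, HasSum (fun i : ℕ => e n * (1 / 2) ^ i) (e n * 2) :=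
    fun n => hasSum_geometric_two.mul_left (e n)
  have hse : Summable e := by
    refine (hsum 0).summable.of_nonneg_of_le (fun n => (hpos n).le) fun n => ?_
    simpa using le_mul_half_pow he 0 n
  have h0 : ∀ n z, ‖F (n + 1) z - F n z‖ ≤ e n := fun n z => by
    simpa using h n 0 (Nat.zero_le n) z
  refine ⟨fun z => F 0 z + ∑' n, (F (n + 1) z - F n z), (hF 0).add ?_, fun n z => ?_⟩
  · refine contDiff_tsum_of_eventually (v := fun _ => e) (fun n => (hF (n + 1)).sub (hF n))
      (fun _ _ => hse) fun k _ => ?_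
    rw [Nat.cofinite_eq_atTop]
    filter_upwards [Filter.eventually_ge_atTop k] with n hn z
    exact h n k hn z
  · have hs : Summable fun n => F (n + 1) z - F n z := hse.of_norm_bounded (h0 · z)
    beta_reduce
    rw [← hs.sum_add_tsum_nat_add n, Finset.sum_range_sub (fun n => F n z)]
    have h₁ : ‖∑' i, (F (i + n + 1) z - F (i + n) z)‖ ≤ e n * 2 :=
      tsum_of_norm_bounded (hsum n) fun i => by
        rw [add_comm i n]
        exact (h0 _ z).trans (le_mul_half_pow he n i)
    calc _ = ‖∑' i, (F (i + n + 1) z - F (i + n) z)‖ := by congr 1; abel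
      _ ≤ 2 * e n := by linarith

theorem tendsto_apply_of_norm_sub_le {E : Type*} [NormedAddCommGroup E] {F : ℕ → E → E}
    {G : E → E} {r : ℕ → ℝ} (hr : Filter.Tendsto r Filter.atTop (nhds 0))
    (h : ∀ n z, ‖G z - F n z‖ ≤ r n) (hG : Continuous G) {u : ℕ → E} {z : E}
    (hu : Filter.Tendsto u Filter.atTop (nhds z)) :
    Filter.Tendsto (fun n => F n (u n)) Filter.atTop (nhds (G z)) := by
  have h₁ : Filter.Tendsto (fun n => G (u n) - F n (u n)) Filter.atTop (nhds 0) :=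
    squeeze_zero_norm (fun n => h n (u n)) hr
  simpa using ((hG.tendsto z).comp hu).sub h₁

theorem tendsto_iterate_of_norm_sub_le {E : Type*} [NormedAddCommGroup E] {F : ℕ → E → E}
    {G : E → E} {r : ℕ → ℝ} (hr : Filter.Tendsto r Filter.atTop (nhds 0))
    (h : ∀ n z, ‖G z - F n z‖ ≤ r n) (hG : Continuous G) (m : ℕ) (z : E) :
    Filter.Tendsto (fun n => (F n)^[m] z) Filter.atTop (nhds (G^[m] z)) := by
  induction m with
  | zero => exact tendsto_const_nhds
  | succ m ih =>
    simp only [Function.iterate_succ_apply']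
    exact tendsto_apply_of_norm_sub_le hr h hG ih

theorem conjTranslation_neg (H : Equiv.Perm (ℝ × ℝ)) (t : ℝ) :
    conjTranslation H (-t) = (conjTranslation H t).symm := by
  ext1 z
  rw [Equiv.eq_symm_apply, conjTranslation_apply, conjTranslation_apply, Equiv.symm_apply_apply,
    add_assoc, show ((-t, 0) + (t, 0) : ℝ × ℝ) = 0 by simp, add_zero, Equiv.apply_symm_apply]

/-- A continuous map of the plane which preserves the strip `|y| ≤ 1` and commutes with the deck
transformation of the annulus. -/
structure IsStripMap (F : ℝ × ℝ → ℝ × ℝ) : Prop where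
  continuous : Continuous F
  map_add_one : ∀ z, F (z + (1, 0)) = F z + (1, 0)
  abs_snd_le_one : ∀ z : ℝ × ℝ, |z.2| ≤ 1 → |(F z).2| ≤ 1

theorem IsAnnulusDiffeo.isStripMap_conjTranslation {H : Equiv.Perm (ℝ × ℝ)}
    (hH : IsAnnulusDiffeo H) (t : ℝ) : IsStripMap (conjTranslation H t) where
  continuous := (hH.contDiff_conjTranslation t).continuous
  map_add_one z := by
    rw [conjTranslation_apply, conjTranslation_apply, hH.symm.map_add_one, add_right_comm,
      hH.map_add_one]
  abs_snd_le_one z hz := hH.abs_snd_le_one (by simpa using hH.symm.abs_snd_le_one hz)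

theorem IsAnnulusDiffeo.measurePreserving_conjTranslation {H : Equiv.Perm (ℝ × ℝ)}
    (hH : IsAnnulusDiffeo H) (t : ℝ) :
    MeasurePreserving (conjTranslation H t) volume volume :=
  hH.measurePreserving.comp
    ((measurePreserving_add_right volume ((t, 0) : ℝ × ℝ)).comp hH.symm.measurePreserving)

theorem IsAnnulusDiffeo.abs_iterate_conjTranslation_sub_le {H : Equiv.Perm (ℝ × ℝ)} {K : ℝ}
    (hK : ∀ z, |(H z).1 - z.1| ≤ K) (t : ℝ) (m : ℕ) (z : ℝ × ℝ) :
    |((conjTranslation H t)^[m] z).1 - z.1 - m * t| ≤ 2 * K := by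
  rw [conjTranslation_iterate]
  have h₁ := hK (H.symm z + (m * t, 0))
  have h₂ := hK (H.symm z)
  rw [Equiv.apply_symm_apply] at h₂
  rw [Prod.fst_add] at h₁
  rw [abs_le] at *
  constructor <;> simp only at * <;> linarith

/-- The plane version of the main construction. -/
theorem exists_strip_limit {α : ℝ} (hα : Liouville α) :
    ∃ F : Equiv.Perm (ℝ × ℝ), ContDiff ℝ (⊤ : ℕ∞) F ∧ ContDiff ℝ (⊤ : ℕ∞) F.symm ∧
      IsStripMap F ∧ IsStripMap F.symm ∧
      (∃ G : ℕ → Equiv.Perm (ℝ × ℝ), (∀ n, IsStripMap (G n)) ∧ (∀ n, IsStripMap (G n).symm) ∧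
        (∀ n, MeasurePreserving (G n) volume volume) ∧
        ∀ z, Filter.Tendsto (fun n => G n z) Filter.atTop (nhds (F z))) ∧
      (∀ ε > 0, ReachesBoundary F ε) ∧
      ∃ K, ∀ (m : ℕ) (z : ℝ × ℝ), |(F^[m] z).1 - z.1 - m * α| ≤ K := by
  obtain ⟨H, e, hH, hpos, he, hD, ⟨K, hK⟩, hreach⟩ := exists_approx_seq hα
  have hlim : Filter.Tendsto e Filter.atTop (nhds 0) := by
    have hgeom : ∀ n, e n ≤ e 0 * (1 / 2) ^ n := fun n => by
      simpa using le_mul_half_pow he 0 n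
    refine squeeze_zero (fun n => (hpos n).le) hgeom ?_
    simpa using (tendsto_pow_atTop_nhds_zero_of_lt_one (by norm_num : (0 : ℝ) ≤ 1 / 2)
      (by norm_num)).const_mul (e 0)
  have hr : Filter.Tendsto (fun n => 2 * e n) Filter.atTop (nhds 0) := by
    simpa using hlim.const_mul 2
  obtain ⟨F, hFs, hF⟩ := exists_contDiff_of_norm_iteratedFDeriv_sub_le
    (fun n => (hH n).contDiff_conjTranslation α) hpos he (hD α (Or.inl rfl))
  obtain ⟨G, hGs, hG⟩ := exists_contDiff_of_norm_iteratedFDeriv_sub_le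
    (fun n => (hH n).contDiff_conjTranslation (-α)) hpos he (hD (-α) (Or.inr rfl))
  have hFt := fun z => tendsto_apply_of_norm_sub_le hr hF hFs.continuous
    (tendsto_const_nhds (x := z))
  have hGt := fun z => tendsto_apply_of_norm_sub_le hr hG hGs.continuous
    (tendsto_const_nhds (x := z))
  have hGF : ∀ z, G (F z) = z := fun z => by
    refine tendsto_nhds_unique (tendsto_apply_of_norm_sub_le hr hG hGs.continuous (hFt z)) ?_
    simp [conjTranslation_neg]
  have hFG : ∀ z, F (G z) = z := fun z => by
    refine tendsto_nhds_unique (tendsto_apply_of_norm_sub_le hr hF hFs.continuous (hGt z)) ?_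
    simp [conjTranslation_neg]
  have hstrip : ∀ {F : ℝ × ℝ → ℝ × ℝ} {F' : ℕ → ℝ × ℝ → ℝ × ℝ}, Continuous F →
      (∀ n, IsStripMap (F' n)) →
      (∀ z, Filter.Tendsto (fun n => F' n z) Filter.atTop (nhds (F z))) → IsStripMap F := by
    intro F F' hF hF' hlim
    refine ⟨hF, fun z => tendsto_nhds_unique (hlim _) ?_, fun z hz => ?_⟩
    · simp only [(hF' _).map_add_one]
      exact (hlim z).add_const _
    · exact le_of_tendsto' (((continuous_snd.tendsto _).comp (hlim z)).abs)
        fun n => (hF' n).abs_snd_le_one z hz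
  refine ⟨⟨F, G, hGF, hFG⟩, hFs, hGs,
    hstrip hFs.continuous (fun n => (hH n).isStripMap_conjTranslation α) hFt,
    hstrip hGs.continuous (fun n => (hH n).isStripMap_conjTranslation (-α)) hGt,
    ⟨fun n => conjTranslation (H n) α, fun n => (hH n).isStripMap_conjTranslation α,
      fun n => ?_, fun n => (hH n).measurePreserving_conjTranslation α, hFt⟩,
    fun ε hε z hz => ?_, 2 * K, fun m z => ?_⟩
  · rw [← conjTranslation_neg]
    exact (hH n).isStripMap_conjTranslation (-α)
  · obtain ⟨n, hn⟩ := (hlim.eventually_lt_const hε).exists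
    obtain ⟨m, hm⟩ := hreach n F (hF (n + 1)) z hz
    exact ⟨m, lt_trans (by linarith) hm⟩
  · have h₁ := (continuous_fst.tendsto _).comp
      (tendsto_iterate_of_norm_sub_le hr hF hFs.continuous m z)
    exact le_of_tendsto' (((h₁.sub_const z.1).sub_const (m * α)).abs)
      fun n => IsAnnulusDiffeo.abs_iterate_conjTranslation_sub_le (hK n) α m z

/-- The inclusion of the strip `ℝ × [-1,1]` into the plane. -/
def stripIncl (z : AnnulusCover) : ℝ × ℝ := (z.1, (z.2 : ℝ))

/-- The retraction of the plane onto the strip `ℝ × [-1,1]`. -/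
def stripProj (z : ℝ × ℝ) : AnnulusCover := (z.1, projIcc (-1) 1 (by norm_num) z.2)

theorem continuous_stripIncl : Continuous stripIncl :=
  continuous_fst.prodMk (continuous_subtype_val.comp continuous_snd)

theorem continuous_stripProj : Continuous stripProj :=
  continuous_fst.prodMk (continuous_projIcc.comp continuous_snd)

theorem abs_snd_stripIncl_le_one (z : AnnulusCover) : |(stripIncl z).2| ≤ 1 := abs_le.2 z.2.2

theorem stripProj_stripIncl (z : AnnulusCover) : stripProj (stripIncl z) = z :=
  Prod.ext rfl (projIcc_val (by norm_num) z.2)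

theorem stripIncl_stripProj {z : ℝ × ℝ} (hz : |z.2| ≤ 1) : stripIncl (stripProj z) = z :=
  Prod.ext rfl (congrArg Subtype.val (projIcc_of_mem (by norm_num) (abs_le.1 hz)))

theorem stripIncl_add_one (z : AnnulusCover) :
    stripIncl (z.1 + 1, z.2) = stripIncl z + (1, 0) := by
  simp [stripIncl]

theorem continuous_annulusProj : Continuous annulusProj :=
  ((AddCircle.continuous_mk' 1).comp continuous_fst).prodMk continuous_snd

theorem surjective_annulusProj : Function.Surjective annulusProj := by
  rintro ⟨x, y⟩
  obtain ⟨x, rfl⟩ := QuotientAddGroup.mk_surjective x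
  exact ⟨(x, y), rfl⟩

theorem isQuotientMap_annulusProj : Topology.IsQuotientMap annulusProj :=
  IsOpenMap.isQuotientMap
    ((QuotientAddGroup.isOpenMap_coe (N := AddSubgroup.zmultiples (1 : ℝ))).prodMap IsOpenMap.id)
    continuous_annulusProj surjective_annulusProj

theorem annulusProj_eq_iff {z w : AnnulusCover} :
    annulusProj z = annulusProj w ↔ ∃ n : ℤ, stripIncl w = stripIncl z + ((n : ℝ), 0) := by
  rw [annulusProj, annulusProj, Prod.mk.injEq, eq_comm, ← sub_eq_zero, ← AddCircle.coe_sub,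
    AddCircle.coe_eq_zero_iff]
  constructor
  · rintro ⟨⟨n, hn⟩, h⟩
    refine ⟨n, Prod.ext ?_ ?_⟩
    · simp only [zsmul_eq_mul, mul_one] at hn
      simp [stripIncl, hn]
    · simp [stripIncl, h]
  · rintro ⟨n, hn⟩
    rw [Prod.ext_iff] at hn
    simp only [stripIncl, Prod.fst_add, Prod.snd_add, add_zero] at hn
    exact ⟨⟨n, by simp [hn.1]⟩, Subtype.ext hn.2.symm⟩

/-- The map of the strip induced by a map of the plane. -/
def coverMap (F : ℝ × ℝ → ℝ × ℝ) (z : AnnulusCover) : AnnulusCover := stripProj (F (stripIncl z))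

/-- The map of the annulus induced by a map of the plane. -/
def annulusMap (F : ℝ × ℝ → ℝ × ℝ) (a : Annulus) : Annulus :=
  annulusProj (coverMap F (Function.surjInv surjective_annulusProj a))

section IsStripMap

variable {F G : ℝ × ℝ → ℝ × ℝ}

theorem IsStripMap.stripIncl_coverMap (hF : IsStripMap F) (z : AnnulusCover) :
    stripIncl (coverMap F z) = F (stripIncl z) :=
  stripIncl_stripProj (hF.abs_snd_le_one _ (abs_snd_stripIncl_le_one z))

theorem IsStripMap.continuous_coverMap (hF : IsStripMap F) : Continuous (coverMap F) :=
  continuous_stripProj.comp (hF.continuous.comp continuous_stripIncl)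

theorem IsStripMap.leftInverse_coverMap (hF : IsStripMap F) (h : Function.LeftInverse G F) :
    Function.LeftInverse (coverMap G) (coverMap F) := fun z => by
  rw [coverMap, hF.stripIncl_coverMap, h, stripProj_stripIncl]

theorem IsStripMap.annulusMap_annulusProj (hF : IsStripMap F) (z : AnnulusCover) :
    annulusMap F (annulusProj z) = annulusProj (coverMap F z) := by
  obtain ⟨n, hn⟩ := annulusProj_eq_iff.1
    (Function.surjInv_eq surjective_annulusProj (annulusProj z))
  refine annulusProj_eq_iff.2 ⟨n, ?_⟩
  rw [hF.stripIncl_coverMap, hF.stripIncl_coverMap, hn, map_add_int_of_map_add_one hF.map_add_one]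

theorem IsStripMap.continuous_annulusMap (hF : IsStripMap F) : Continuous (annulusMap F) := by
  rw [isQuotientMap_annulusProj.continuous_iff]
  refine (continuous_annulusProj.comp hF.continuous_coverMap).congr fun z => ?_
  exact (hF.annulusMap_annulusProj z).symm

theorem IsStripMap.leftInverse_annulusMap (hF : IsStripMap F) (hG : IsStripMap G)
    (h : Function.LeftInverse G F) :
    Function.LeftInverse (annulusMap G) (annulusMap F) := fun a => by
  obtain ⟨z, rfl⟩ := surjective_annulusProj a
  rw [hF.annulusMap_annulusProj, hG.annulusMap_annulusProj, hF.leftInverse_coverMap h]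

theorem IsStripMap.iterate_annulusMap (hF : IsStripMap F) (m : ℕ) (z : AnnulusCover) :
    (annulusMap F)^[m] (annulusProj z) = annulusProj ((coverMap F)^[m] z) :=
  ((Function.Semiconj.iterate_right (f := annulusProj) (ga := coverMap F) (gb := annulusMap F)
    (fun z => (hF.annulusMap_annulusProj z).symm) m) z).symm

theorem IsStripMap.stripIncl_iterate_coverMap (hF : IsStripMap F) (m : ℕ) (z : AnnulusCover) :
    stripIncl ((coverMap F)^[m] z) = F^[m] (stripIncl z) :=
  (Function.Semiconj.iterate_right (f := stripIncl) (ga := coverMap F) (gb := F)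
    hF.stripIncl_coverMap m) z

end IsStripMap

theorem measurePreserving_projIcc :
    MeasurePreserving (projIcc (-1 : ℝ) 1 (by norm_num)) (volume.restrict (Icc (-1) 1)) volume := by
  refine ⟨continuous_projIcc.measurable, ?_⟩
  ext s hs
  rw [Measure.map_apply continuous_projIcc.measurable hs,
    Measure.restrict_apply (continuous_projIcc.measurable hs),
    Measure.Subtype.volume_def, Measure.comap_apply _ Subtype.val_injective
      (fun t ht => (MeasurableEmbedding.subtype_coe measurableSet_Icc).measurableSet_image.2 ht) _ hs]
  congr 1
  ext x
  constructor
  · rintro ⟨h₁, h₂⟩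
    rw [mem_preimage, projIcc_of_mem _ h₂] at h₁
    exact ⟨_, h₁, rfl⟩
  · rintro ⟨y, hy, rfl⟩
    exact ⟨by rwa [mem_preimage, projIcc_val], y.2⟩

theorem measurePreserving_annulusProj_stripProj :
    MeasurePreserving (annulusProj ∘ stripProj)
      (volume.restrict (Ioc (0 : ℝ) 1 ×ˢ Icc (-1 : ℝ) 1)) volume := by
  have h := (AddCircle.measurePreserving_mk 1 0).prod measurePreserving_projIcc
  rw [Measure.prod_restrict, zero_add] at h
  exact h

theorem isAddFundamentalDomain_Ioc_prod_univ {F : Equiv.Perm (ℝ × ℝ)}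
    (hF : IsStripMap F.symm) :
    IsAddFundamentalDomain (AddSubgroup.zmultiples ((1 : ℝ), (0 : ℝ)))
      (F.symm ⁻¹' (Ioc (0 : ℝ) 1 ×ˢ univ)) volume := by
  refine IsAddFundamentalDomain.mk'
    (hF.continuous.measurable (measurableSet_Ioc.prod .univ)).nullMeasurableSet fun z => ?_
  have hsmul : ∀ n : ℤ, n • ((1 : ℝ), (0 : ℝ)) = ((n : ℝ), 0) := fun n => by simp
  obtain ⟨n, hn, huniq⟩ := existsUnique_add_zsmul_mem_Ioc one_pos (F.symm z).1 0
  have hmem : ∀ n : ℤ, ((n : ℝ), (0 : ℝ)) + z ∈ F.symm ⁻¹' (Ioc (0 : ℝ) 1 ×ˢ univ) ↔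
      (F.symm z).1 + n • (1 : ℝ) ∈ Ioc (0 : ℝ) (0 + 1) := fun n => by
    rw [mem_preimage, add_comm, map_add_int_of_map_add_one hF.map_add_one]
    simp
  refine ⟨⟨_, n, rfl⟩, ?_, ?_⟩
  · change n • ((1 : ℝ), (0 : ℝ)) + z ∈ _
    rw [hsmul, hmem]
    exact hn
  · rintro ⟨_, k, rfl⟩ hk
    change k • ((1 : ℝ), (0 : ℝ)) + z ∈ _ at hk
    rw [hsmul, hmem] at hk
    exact Subtype.ext (congrArg (· • ((1 : ℝ), (0 : ℝ))) (huniq k hk))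

theorem measurePreserving_annulusMap {F : Equiv.Perm (ℝ × ℝ)} (hF : IsStripMap F)
    (hF' : IsStripMap F.symm) (h : MeasurePreserving F volume volume) :
    MeasurePreserving (annulusMap F) volume volume := by
  refine ⟨hF.continuous_annulusMap.measurable, ?_⟩
  ext B hB
  set D : Set (ℝ × ℝ) := Ioc (0 : ℝ) 1 ×ˢ univ with hD
  set S : Set (ℝ × ℝ) := univ ×ˢ Icc (-1 : ℝ) 1 with hS
  have hSmem : ∀ z : ℝ × ℝ, z ∈ S ↔ |z.2| ≤ 1 := fun z => by simp [hS, abs_le]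
  have hDS : Ioc (0 : ℝ) 1 ×ˢ Icc (-1 : ℝ) 1 = S ∩ D := by
    rw [hD, hS, prod_inter_prod, univ_inter, inter_univ]
  have hq := measurePreserving_annulusProj_stripProj
  rw [hDS] at hq
  set q : ℝ × ℝ → Annulus := annulusProj ∘ stripProj with hqdef
  have hSmeas : MeasurableSet S := MeasurableSet.univ.prod measurableSet_Icc
  have hDmeas : MeasurableSet D := measurableSet_Ioc.prod .univ
  have hvol : ∀ B : Set Annulus, MeasurableSet B →
      volume B = volume ((q ⁻¹' B ∩ S) ∩ D) := fun B hB => by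
    rw [← hq.measure_preimage hB.nullMeasurableSet, Measure.restrict_apply (hq.measurable hB),
      inter_assoc]
  have hpre : q ⁻¹' (annulusMap F ⁻¹' B) ∩ S = F ⁻¹' (q ⁻¹' B ∩ S) := by
    ext z
    have hiff : z ∈ S ↔ F z ∈ S := by
      rw [hSmem, hSmem]
      refine ⟨hF.abs_snd_le_one z, fun hz => ?_⟩
      simpa using hF'.abs_snd_le_one _ hz
    simp only [mem_inter_iff, mem_preimage]
    rw [← hiff]
    refine and_congr_left fun hz => ?_
    rw [hqdef, Function.comp_apply, Function.comp_apply, hF.annulusMap_annulusProj, coverMap,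
      stripIncl_stripProj ((hSmem z).1 hz)]
  have hA : MeasurableSet (q ⁻¹' B ∩ S) := (hq.measurable hB).inter hSmeas
  have hper : ∀ g : AddSubgroup.zmultiples ((1 : ℝ), (0 : ℝ)),
      (fun z => g +ᵥ z) ⁻¹' (q ⁻¹' B ∩ S) = q ⁻¹' B ∩ S := by
    rintro ⟨_, n, rfl⟩
    ext z
    have hz : (n • ((1 : ℝ), (0 : ℝ)) + z) = z + ((n : ℝ), 0) := by simp [add_comm]
    have hqz : q (z + ((n : ℝ), 0)) = q z := by
      refine (annulusProj_eq_iff.2 ⟨n, ?_⟩).symm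
      simp [stripIncl, stripProj]
    change n • ((1 : ℝ), (0 : ℝ)) + z ∈ q ⁻¹' B ∩ S ↔ _
    rw [hz, mem_inter_iff, mem_inter_iff, mem_preimage, mem_preimage, hqz, hSmem, hSmem]
    simp
  have hid : IsStripMap (Equiv.refl (ℝ × ℝ)).symm := ⟨continuous_id, fun _ => rfl, fun _ h => h⟩
  rw [Measure.map_apply hF.continuous_annulusMap.measurable hB,
    hvol _ (hF.continuous_annulusMap.measurable hB), hvol _ hB, hpre]
  have hDF : F ⁻¹' (q ⁻¹' B ∩ S) ∩ D = F ⁻¹' ((q ⁻¹' B ∩ S) ∩ F.symm ⁻¹' D) := by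
    ext z
    simp
  rw [hDF, h.measure_preimage
    (hA.inter (hF'.continuous.measurable hDmeas)).nullMeasurableSet]
  exact (isAddFundamentalDomain_Ioc_prod_univ hF').measure_set_eq
    (isAddFundamentalDomain_Ioc_prod_univ hid) hA hper

theorem MeasureTheory.MeasurePreserving.of_tendsto {X : Type*} [TopologicalSpace X]
    [MeasurableSpace X] [HasOuterApproxClosed X] [BorelSpace X] {μ : Measure X} [IsFiniteMeasure μ]
    {f : ℕ → X → X} {g : X → X} (hf : ∀ n, MeasurePreserving (f n) μ μ) (hg : Continuous g)
    (h : ∀ x, Filter.Tendsto (fun n => f n x) Filter.atTop (nhds (g x))) :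
    MeasurePreserving g μ μ := by
  refine ⟨hg.measurable, ext_of_forall_integral_eq_of_IsFiniteMeasure fun φ => ?_⟩
  rw [integral_map hg.measurable.aemeasurable φ.continuous.aestronglyMeasurable]
  refine tendsto_nhds_unique (tendsto_integral_of_dominated_convergence (F := fun n x => φ (f n x))
    (fun _ => ‖φ‖) (fun n => ?_) (integrable_const _)
    (fun n => .of_forall fun x => φ.norm_coe_le_norm _)
    (.of_forall fun x => (φ.continuous.tendsto _).comp (h x))) ?_
  · exact φ.continuous.measurable.comp (hf n).measurable |>.aestronglyMeasurable
  · refine tendsto_const_nhds.congr fun n => ?_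
    conv_lhs => rw [← (hf n).map_eq]
    rw [integral_map (hf n).measurable.aemeasurable φ.continuous.aestronglyMeasurable]

theorem integral_eq_of_abs_birkhoffSum_sub_le {X : Type*} [MeasurableSpace X] {μ : Measure X}
    [IsProbabilityMeasure μ] {f : X → X} (hf : MeasurePreserving f μ μ) {φ : X → ℝ}
    (hφ : Integrable φ μ) {α K : ℝ} (h : ∀ m x, |birkhoffSum f φ m x - m * α| ≤ K) :
    ∫ x, φ x ∂μ = α := by
  have hinter : ∀ m : ℕ, Integrable (fun x => φ (f^[m] x)) μ := fun m =>
    (hf.iterate m).integrable_comp_of_integrable hφ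
  have hsum : ∀ m : ℕ, ∫ x, birkhoffSum f φ m x ∂μ = m * ∫ x, φ x ∂μ := by
    intro m
    simp only [birkhoffSum]
    rw [integral_finsetSum _ fun i _ => hinter i, Finset.sum_congr rfl fun i _ => ?_,
      Finset.sum_const, Finset.card_range, nsmul_eq_mul]
    have h₁ := (hf.iterate i).map_eq
    conv_rhs => rw [← h₁]
    exact (integral_map (hf.iterate i).measurable.aemeasurable
      (by rw [h₁]; exact hφ.aestronglyMeasurable)).symm
  have hbound : ∀ m : ℕ, m * |∫ x, φ x ∂μ - α| ≤ K := by
    intro m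
    have hb : Integrable (fun x => birkhoffSum f φ m x) μ :=
      integrable_finsetSum _ fun i _ => hinter i
    have h₂ : ∫ x, (birkhoffSum f φ m x - m * α) ∂μ = m * (∫ x, φ x ∂μ - α) := by
      rw [integral_sub hb (integrable_const _), hsum]
      simp
      ring
    have h₃ := norm_integral_le_of_norm_le_const (μ := μ)
      (f := fun x => birkhoffSum f φ m x - m * α) (.of_forall (h m))
    rw [h₂, Real.norm_eq_abs, abs_mul, Nat.abs_cast] at h₃
    simpa using h₃
  by_contra hne
  have hpos : 0 < |∫ x, φ x ∂μ - α| := abs_pos.2 (sub_ne_zero.2 hne)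
  obtain ⟨m, hm⟩ := exists_nat_gt (K / |∫ x, φ x ∂μ - α|)
  rw [div_lt_iff₀ hpos] at hm
  exact absurd (hbound m) (not_le.2 hm)

/-- The horizontal displacement of a map of the plane, as a function on the annulus. -/
def displacement (F : ℝ × ℝ → ℝ × ℝ) (a : Annulus) : ℝ :=
  (F (stripIncl (Function.surjInv surjective_annulusProj a))).1 -
    (Function.surjInv surjective_annulusProj a).1

section displacement

variable {F : ℝ × ℝ → ℝ × ℝ}

theorem IsStripMap.displacement_annulusProj (hF : IsStripMap F) (z : AnnulusCover) :
    displacement F (annulusProj z) = (F (stripIncl z)).1 - z.1 := by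
  obtain ⟨n, hn⟩ := annulusProj_eq_iff.1
    (Function.surjInv_eq surjective_annulusProj (annulusProj z))
  have h : z.1 = (Function.surjInv surjective_annulusProj (annulusProj z)).1 + n :=
    congrArg Prod.fst hn
  rw [displacement, hn, map_add_int_of_map_add_one hF.map_add_one, Prod.fst_add, h]
  ring

theorem IsStripMap.continuous_displacement (hF : IsStripMap F) : Continuous (displacement F) := by
  rw [isQuotientMap_annulusProj.continuous_iff]
  refine (((continuous_fst.comp hF.continuous).comp continuous_stripIncl).sub
    continuous_fst).congr fun z => ?_
  exact (hF.displacement_annulusProj z).symm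

theorem IsStripMap.birkhoffSum_displacement (hF : IsStripMap F) (m : ℕ) (z : AnnulusCover) :
    birkhoffSum (annulusMap F) (displacement F) m (annulusProj z) =
      (F^[m] (stripIncl z)).1 - (stripIncl z).1 := by
  induction m with
  | zero => simp
  | succ m ih =>
    rw [birkhoffSum_succ, ih, hF.iterate_annulusMap, hF.displacement_annulusProj,
      hF.stripIncl_iterate_coverMap, Function.iterate_succ_apply',
      ← hF.stripIncl_iterate_coverMap]
    change _ - _ + (_ - (stripIncl ((coverMap F)^[m] z)).1) = _
    ring

end displacement

theorem exists_annulusProj_eq (a : Annulus) :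
    ∃ z : AnnulusCover, annulusProj z = a ∧ z.1 ∈ Icc (0 : ℝ) 1 := by
  obtain ⟨z, rfl⟩ := surjective_annulusProj a
  refine ⟨(Int.fract z.1, z.2), annulusProj_eq_iff.2 ⟨⌊z.1⌋, ?_⟩,
    Int.fract_nonneg _, (Int.fract_lt_one _).le⟩
  simp [stripIncl]

theorem IsStripMap.not_exists_isCompact_image_eq {F : ℝ × ℝ → ℝ × ℝ} (hF : IsStripMap F)
    (h : ∀ ε > 0, ReachesBoundary F ε) :
    ¬ ∃ K : Set Annulus, K.Nonempty ∧ IsCompact K ∧ annulusMap F '' K = K ∧ K ⊆ annulusInt := by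
  rintro ⟨K, hne, hK, hinv, hinter⟩
  obtain ⟨b, hb, hmax⟩ := hK.exists_isMaxOn hne
    (f := fun a : Annulus => |(a.2 : ℝ)|) (by fun_prop)
  have hb1 : |(b.2 : ℝ)| < 1 := abs_lt.2 (hinter hb)
  obtain ⟨a, ha⟩ := hne
  obtain ⟨z, rfl, hz⟩ := exists_annulusProj_eq a
  obtain ⟨m, hm⟩ := h (1 - |(b.2 : ℝ)|) (by linarith) (stripIncl z) ⟨hz, z.2.2⟩
  have hmem : (annulusMap F)^[m] (annulusProj z) ∈ K :=
    (mapsTo_iff_image_subset.2 hinv.subset).iterate m ha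
  rw [hF.iterate_annulusMap] at hmem
  have hle : |(stripIncl ((coverMap F)^[m] z)).2| ≤ |(b.2 : ℝ)| := hmax hmem
  rw [hF.stripIncl_iterate_coverMap] at hle
  linarith

theorem isFiniteMeasure_volume_annulus : IsFiniteMeasure (volume : Measure Annulus) := by
  have : IsFiniteMeasure ((volume : Measure (ℝ × ℝ)).restrict
      (Ioc (0 : ℝ) 1 ×ˢ Icc (-1 : ℝ) 1)) := by
    rw [isFiniteMeasure_restrict, Measure.volume_eq_prod, Measure.prod_prod]
    simp
  rw [← measurePreserving_annulusProj_stripProj.map_eq]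
  infer_instance

/-- Theorem (1): for every Liouville number `α` there is an area-preserving NICIS `C^∞`
diffeomorphism of the closed annulus with rotation number `α`. -/
theorem stmt_0 (α : ℝ) (hα : Liouville α) :
    ∃ (f : Annulus ≃ₜ Annulus) (ft : AnnulusCover ≃ₜ AnnulusCover),
      MeasurePreserving f volume volume ∧
      IsLift f ft ∧
      (∃ g : ℝ × ℝ → ℝ × ℝ, ContDiffOn ℝ (⊤ : ℕ∞) g (Set.univ ×ˢ Set.Icc (-1 : ℝ) 1) ∧
        ∀ (x : ℝ) (y : Set.Icc (-1 : ℝ) 1),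
          g (x, (y : ℝ)) = ((ft (x, y)).1, ((ft (x, y)).2 : ℝ))) ∧
      (∃ g : ℝ × ℝ → ℝ × ℝ, ContDiffOn ℝ (⊤ : ℕ∞) g (Set.univ ×ˢ Set.Icc (-1 : ℝ) 1) ∧
        ∀ (x : ℝ) (y : Set.Icc (-1 : ℝ) 1),
          g (x, (y : ℝ)) = ((ft.symm (x, y)).1, ((ft.symm (x, y)).2 : ℝ))) ∧
      NICIS f ∧
      (∃ F : Annulus → ℝ, Continuous F ∧
        (∀ z : AnnulusCover, F (annulusProj z) = (ft z).1 - z.1) ∧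
        ∀ μ : Measure Annulus, IsProbabilityMeasure μ → MeasurePreserving f μ μ →
          ∫ z, F z ∂μ = α) := by
  obtain ⟨F, hFs, hGs, hF, hG, ⟨G, hGn, hGn', hGm, hlim⟩, hreach, K, hK⟩ := exists_strip_limit hα
  have hGF : Function.LeftInverse F.symm F := F.symm_apply_apply
  have hFG : Function.LeftInverse F F.symm := F.apply_symm_apply
  let f : Annulus ≃ₜ Annulus :=
    { toFun := annulusMap F
      invFun := annulusMap F.symm
      left_inv := hF.leftInverse_annulusMap hG hGF
      right_inv := hG.leftInverse_annulusMap hF hFG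
      continuous_toFun := hF.continuous_annulusMap
      continuous_invFun := hG.continuous_annulusMap }
  let ft : AnnulusCover ≃ₜ AnnulusCover :=
    { toFun := coverMap F
      invFun := coverMap F.symm
      left_inv := hF.leftInverse_coverMap hGF
      right_inv := hG.leftInverse_coverMap hFG
      continuous_toFun := hF.continuous_coverMap
      continuous_invFun := hG.continuous_coverMap }
  have hfinite := isFiniteMeasure_volume_annulus
  have hfp : MeasurePreserving f volume volume := by
    refine .of_tendsto (fun n => measurePreserving_annulusMap (hGn n) (hGn' n) (hGm n))
      f.continuous fun a => ?_
    obtain ⟨z, rfl⟩ := surjective_annulusProj a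
    simp only [(hGn _).annulusMap_annulusProj]
    change Filter.Tendsto _ _ (nhds (annulusMap F (annulusProj z)))
    rw [hF.annulusMap_annulusProj]
    exact ((continuous_annulusProj.comp continuous_stripProj).tendsto _).comp (hlim (stripIncl z))
  refine ⟨f, ft, hfp, ⟨fun z => ?_, hF.annulusMap_annulusProj⟩,
    ⟨F, hFs.contDiffOn, fun x y => (hF.stripIncl_coverMap (x, y)).symm⟩,
    ⟨F.symm, hGs.contDiffOn, fun x y => (hG.stripIncl_coverMap (x, y)).symm⟩,
    hF.not_exists_isCompact_image_eq hreach,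
    displacement F, hF.continuous_displacement, hF.displacement_annulusProj, fun μ hμ hfμ => ?_⟩
  · change coverMap F (z.1 + 1, z.2) = ((coverMap F z).1 + 1, (coverMap F z).2)
    rw [coverMap, stripIncl_add_one, hF.map_add_one]
    simp [coverMap, stripProj]
  · refine integral_eq_of_abs_birkhoffSum_sub_le (K := K) hfμ
      (hF.continuous_displacement.integrable_of_hasCompactSupport (.of_compactSpace _))
      fun m a => ?_
    obtain ⟨z, rfl⟩ := surjective_annulusProj a
    change |birkhoffSum (annulusMap F) (displacement F) m (annulusProj z) - m * α| ≤ K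
    rw [hF.birkhoffSum_displacement]
    exact hK m (stripIncl z)
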